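/- arXiv:1906.03049 — 3 statements merged into one kernel-verified Lean document; each statement's English description precedes it below -/
import Mathlib

section
/- Let q ≤ 1/5 and σ ≥ 4, and let ω be the privacy loss distribution density of the Poisson-subsampled Gaussian mechanism. Suppose λ satisfies 1 < λ ≤ (1/2)σ²c − 2·log σ and λ ≤ ( (1/2)σ²c − log 5 − 2·log σ ) / ( c + log(qλ) + 1/(2σ²) ), where c = log(1 + 1/(q(λ − 1))). Then the moment generating function of ω satisfies ∫_ℝ e^{λs}·ω(s) ds ≤ 1 + 2q²(λ + 1)λ/σ². -/
open MeasureTheory Real Set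

/-- Density `f_X` of the Poisson-subsampled Gaussian mechanism:
`f(t) = (1/√(2πσ²))·(q e^{−(t−1)²/(2σ²)} + (1−q) e^{−t²/(2σ²)})`. -/
noncomputable def ffun (σ q : ℝ) (t : ℝ) : ℝ :=
  (1 / Real.sqrt (2 * Real.pi * σ ^ 2)) *
    (q * Real.exp (-(t - 1) ^ 2 / (2 * σ ^ 2)) + (1 - q) * Real.exp (-t ^ 2 / (2 * σ ^ 2)))

/-- Inverse privacy loss function `g(s) = σ²·log((e^s − (1−q))/q) + 1/2`. -/
noncomputable def gfun (σ q : ℝ) (s : ℝ) : ℝ :=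
  σ ^ 2 * Real.log ((Real.exp s - (1 - q)) / q) + 1 / 2

/-- Derivative `g'(s) = σ² e^s / (e^s − (1−q))`. -/
noncomputable def gderiv (σ q : ℝ) (s : ℝ) : ℝ :=
  σ ^ 2 * Real.exp s / (Real.exp s - (1 - q))

/-- Privacy loss distribution density of the Poisson-subsampled Gaussian mechanism:
`ω(s) = f(g(s))·g'(s)` for `s > log(1−q)` and `0` otherwise. -/
noncomputable def pld (σ q : ℝ) : ℝ → ℝ :=
  (Set.Ioi (Real.log (1 - q))).indicator (fun s => ffun σ q (gfun σ q s) * gderiv σ q s)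

lemma aux_num (σ q lam c K : ℝ) (hq0 : 0 < q) (hq : q ≤ 1 / 5) (hσ : 4 ≤ σ) (hlam : 1 < lam)
    (hK : K = q * (lam - 1)) (hc : c = Real.log (1 + 1 / K))
    (h2 : lam ≤ 1 / 2 * σ ^ 2 * c - 2 * Real.log σ) :
    σ ^ 2 * Real.exp (-(σ ^ 2 * c ^ 2 / 2) - c / 2) ≤ 1 / 5 * K ^ 2 := by
  have hK0 : 0 < K := by rw [hK]; exact mul_pos hq0 (by linarith)
  have hec : Real.exp c = 1 + 1 / K := by
    rw [hc, Real.exp_log (by positivity)]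
  have e1 := Real.exp_one_gt_d9
  have e2 := Real.exp_one_lt_d9
  have hs16 : 16 ≤ σ ^ 2 := by nlinarith
  rcases le_or_gt 1 c with h1 | h1
  · have hKe : Real.exp (-c) ≤ K := by
      rw [Real.exp_neg, hec, inv_le_comm₀ (by positivity) hK0]
      rw [inv_eq_one_div]; linarith
    have hx : σ ^ 2 / 4 ≤ Real.exp (σ ^ 2 / 4 - 1) := by
      have := Real.add_one_le_exp (σ ^ 2 / 4 - 1); linarith
    have h20 : 20 ≤ Real.exp (1 + 5 / 2 * c) := by
      have : Real.exp 3 ≤ Real.exp (1 + 5 / 2 * c) := Real.exp_le_exp.2 (by linarith)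
      have h3 : Real.exp 3 = Real.exp 1 ^ 3 := by rw [← Real.exp_nat_mul]; norm_num
      have : (2.718:ℝ) ^ 3 ≤ Real.exp 1 ^ 3 := by gcongr; linarith
      norm_num at this; linarith
    calc σ ^ 2 * Real.exp (-(σ ^ 2 * c ^ 2 / 2) - c / 2)
        ≤ (4 * Real.exp (σ ^ 2 / 4 - 1)) * Real.exp (-(σ ^ 2 / 4) - 4 * c - c / 2) := by
          gcongr
          · linarith
          · nlinarith [mul_nonneg (by linarith : (0:ℝ) ≤ σ ^ 2 - 16) (by linarith : 0 ≤ c - 1), mul_nonneg (by positivity : 0 ≤ σ ^ 2 * c) (by linarith : 0 ≤ c - 1)]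
      _ = 4 * Real.exp (-(1 + 5 / 2 * c)) * Real.exp (-c) ^ 2 := by
          rw [← Real.exp_nat_mul, mul_assoc, mul_assoc, ← Real.exp_add, ← Real.exp_add]
          congr 2; push_cast; ring
      _ ≤ 1 / 5 * K ^ 2 := by
          gcongr
          rw [Real.exp_neg, ← div_eq_mul_inv, div_le_iff₀ (Real.exp_pos _)]
          linarith
  · have hKh : 1 / 2 < K := by
      have : Real.exp c < Real.exp 1 := Real.exp_lt_exp.2 h1
      rw [hec] at this
      have h3 : 1 / K < 2 := by linarith
      rw [div_lt_iff₀ hK0] at h3; linarith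
    have hcl : 2 / (2 * K + 1) ≤ c := by
      have := Real.le_log_one_add_of_nonneg (x := 1 / K) (by positivity)
      rw [← hc] at this
      refine le_trans (le_of_eq ?_) this
      field_simp
      try ring
    have hc0 : 0 < c := lt_of_lt_of_le (by positivity) hcl
    have hcl' : 2 ≤ c * (2 * K + 1) := by rwa [div_le_iff₀ (by positivity)] at hcl
    have hlog : 5 / 4 ≤ Real.log σ := by
      have h4 : Real.log 4 ≤ Real.log σ := Real.log_le_log (by norm_num) hσ
      have h5 : Real.log 4 = 2 * Real.log 2 := by
        rw [show (4:ℝ) = 2 ^ 2 by norm_num, Real.log_pow]; norm_num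
      have := Real.log_two_gt_d9
      linarith
    have hlamK : 1 + 5 * K ≤ lam := by
      have : 5 * K ≤ lam - 1 := by rw [hK]; nlinarith
      linarith
    have hy : c * (5 * K + 7 / 2) ≤ σ ^ 2 * c ^ 2 / 2 := by
      have : 5 * K + 7 / 2 ≤ 1 / 2 * σ ^ 2 * c := by linarith
      nlinarith
    set y := σ ^ 2 * c ^ 2 / 2 with hyd
    have hrK : 1 / 2 ≤ c * K := by nlinarith
    have key : y * Real.exp (-y) ≤ 1 / 10 * (c * K) ^ 2 := by
      have hx : y / 5 ≤ Real.exp (y / 5 - 1) := by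
        have := Real.add_one_le_exp (y / 5 - 1); linarith
      have hb : y * Real.exp (-y) ≤ 5 * Real.exp (-(4 / 5 * y + 1)) := by
        calc y * Real.exp (-y) ≤ (5 * Real.exp (y / 5 - 1)) * Real.exp (-y) := by
              gcongr; linarith
          _ = _ := by
              rw [mul_assoc, ← Real.exp_add]; congr 2; ring
      have e5 : (148:ℝ) ≤ Real.exp 5 := by
        have h3 : Real.exp 5 = Real.exp 1 ^ 5 := by rw [← Real.exp_nat_mul]; norm_num
        have : (2.718:ℝ) ^ 5 ≤ Real.exp 1 ^ 5 := by gcongr; linarith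
        norm_num at this; linarith
      rcases le_or_gt 1 K with hk | hk
      · have hr : 2 / 3 ≤ c * K := by nlinarith
        have hy5 : 5 ≤ y := by linarith
        have : Real.exp (-(4 / 5 * y + 1)) ≤ 1 / 148 := by
          rw [Real.exp_neg, inv_eq_one_div]
          apply one_div_le_one_div_of_le (by norm_num)
          exact e5.trans (Real.exp_le_exp.2 (by linarith))
        have h9 : (2 / 3) ^ 2 ≤ (c * K) ^ 2 := by gcongr
        linarith
      · have hcc : 2 / 3 ≤ c := by nlinarith
        have hy5 : 5 + 2 / 3 ≤ y := by linarith
        have : Real.exp (-(4 / 5 * y + 1)) ≤ 1 / 200 := by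
          rw [Real.exp_neg, inv_eq_one_div]
          apply one_div_le_one_div_of_le (by norm_num)
          have h6 : Real.exp (5 + 8 / 15) ≤ Real.exp (4 / 5 * y + 1) :=
            Real.exp_le_exp.2 (by linarith)
          rw [Real.exp_add] at h6
          have h7 := Real.add_one_le_exp (8 / 15 : ℝ)
          have h8 := mul_le_mul e5 h7 (by norm_num) (Real.exp_pos 5).le
          norm_num at h8
          norm_num at h6
          linarith
        have h9 : (1 / 2) ^ 2 ≤ (c * K) ^ 2 := by gcongr
        linarith
    have hσy : σ ^ 2 = 2 * y / c ^ 2 := by rw [hyd]; field_simp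
    calc σ ^ 2 * Real.exp (-y - c / 2) ≤ σ ^ 2 * Real.exp (-y) := by
          gcongr; linarith
      _ = 2 * (y * Real.exp (-y)) / c ^ 2 := by rw [hσy]; ring
      _ ≤ 2 * (1 / 10 * (c * K) ^ 2) / c ^ 2 := by gcongr
      _ = 1 / 5 * K ^ 2 := by field_simp; norm_num

lemma aux_taylor (lam x : ℝ) (hlam : 1 < lam) (hx1 : -1 < x) (hx2 : x * (lam - 1) ≤ 1) :
    (1 + x) ^ (lam + 1) ≤ 1 + (lam + 1) * x + Real.exp 1 / 2 * ((lam + 1) * lam) * x ^ 2 := by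
  have e1 := Real.exp_one_gt_d9
  let h : ℝ → ℝ := fun x => 1 + (lam + 1) * x + Real.exp 1 / 2 * ((lam + 1) * lam) * x ^ 2
    - (1 + x) ^ (lam + 1)
  have hd : ∀ x : ℝ, HasDerivAt h
      ((lam + 1) * (1 + Real.exp 1 * lam * x - (1 + x) ^ lam)) x := by
    intro x
    have a1 : HasDerivAt (fun x : ℝ => 1 + x) 1 x := (hasDerivAt_id x).const_add 1
    have a2 := a1.rpow_const (p := lam + 1) (Or.inr (by linarith))
    have a3 := (((hasDerivAt_id x).const_mul (lam + 1)).const_add 1).add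
      (((hasDerivAt_id x).pow 2).const_mul (Real.exp 1 / 2 * ((lam + 1) * lam)))
    refine (a3.sub a2).congr_deriv ?_
    simp
    ring
  have hcont : Continuous h := continuous_iff_continuousAt.2 fun x => (hd x).continuousAt
  have hdiff : Differentiable ℝ h := fun x => (hd x).differentiableAt
  have h0 : h 0 = 0 := by simp [h]
  suffices 0 ≤ h x by simp only [h] at this; linarith
  rw [← h0]
  rcases le_or_gt x 0 with hx | hx
  · have : AntitoneOn h (Set.Icc x 0) := by
      apply antitoneOn_of_deriv_nonpos (convex_Icc _ _) hcont.continuousOn hdiff.differentiableOn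
      intro t ht
      rw [interior_Icc] at ht
      rw [(hd t).deriv]
      have := one_add_mul_self_le_rpow_one_add (s := t) (by linarith [ht.1]) hlam.le
      have h3 : Real.exp 1 * (lam * t) ≤ 1 * (lam * t) :=
        mul_le_mul_of_nonpos_right (by linarith) (by nlinarith [ht.2])
      apply mul_nonpos_of_nonneg_of_nonpos (by linarith)
      nlinarith
    exact this (by simp [hx]) (by simp [hx]) hx
  · have : MonotoneOn h (Set.Icc 0 x) := by
      apply monotoneOn_of_deriv_nonneg (convex_Icc _ _) hcont.continuousOn hdiff.differentiableOn
      intro t ht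
      rw [interior_Icc] at ht
      rw [(hd t).deriv]
      have t0 := ht.1
      have ht1 : 0 < 1 + t := by linarith
      have b1 := one_add_mul_self_le_rpow_one_add (s := -(t / (1 + t)))
        (by rw [neg_le_neg_iff, div_le_one ht1]; linarith) hlam.le
      have b2 : 1 + -(t / (1 + t)) = (1 + t)⁻¹ := by field_simp; ring
      rw [b2, Real.inv_rpow ht1.le] at b1
      have hp : 0 < (1 + t) ^ lam := Real.rpow_pos_of_pos ht1 _
      have b3 : (1 + t) ^ lam = (1 + t) ^ (lam - 1) * (1 + t) := by
        rw [← Real.rpow_add_one ht1.ne']; congr 1; ring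
      have b4 : (1 + t) ^ (lam - 1) ≤ Real.exp 1 := by
        calc (1 + t) ^ (lam - 1) ≤ (Real.exp t) ^ (lam - 1) := by
              apply Real.rpow_le_rpow ht1.le _ (by linarith)
              linarith [Real.add_one_le_exp t]
          _ = Real.exp (t * (lam - 1)) := (Real.exp_mul _ _).symm
          _ ≤ Real.exp 1 := Real.exp_le_exp.2 (by nlinarith [ht.2])
      have b5 : (1 + t) ^ lam ≤ 1 + lam * t * (1 + t) ^ (lam - 1) := by
        have := mul_le_mul_of_nonneg_left b1 hp.le
        rw [mul_inv_cancel₀ hp.ne'] at this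
        have b6 : (1 + t) ^ lam * (1 + lam * -(t / (1 + t)))
          = (1 + t) ^ lam - lam * t * (1 + t) ^ (lam - 1) := by
          rw [b3]; field_simp; ring
        linarith
      apply mul_nonneg (by linarith)
      have := mul_le_mul_of_nonneg_left b4 (by positivity : 0 ≤ lam * t)
      linarith
    exact this (by simp [hx.le]) (by simp [hx.le]) hx.le

/-- likelihood ratio -/
noncomputable def Rr (σ q t : ℝ) : ℝ := 1 - q + q * Real.exp ((2 * t - 1) / (2 * σ ^ 2))

lemma aux_cov (σ q lam : ℝ) (hq0 : 0 < q) (hq : q < 1) (hσ : 0 < σ) :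
    (∫ s, Real.exp (lam * s) * pld σ q s) = ∫ t, ffun σ q t * (Rr σ q t) ^ lam := by
  have hR : ∀ t, 0 < Rr σ q t := fun t => by
    unfold Rr; have := mul_pos hq0 (Real.exp_pos ((2 * t - 1) / (2 * σ ^ 2))); linarith
  have h1 : (∫ s, Real.exp (lam * s) * pld σ q s)
      = ∫ s in Set.Ioi (Real.log (1 - q)),
        Real.exp (lam * s) * (ffun σ q (gfun σ q s) * gderiv σ q s) := by
    rw [← integral_indicator measurableSet_Ioi]
    congr 1; ext s
    unfold pld
    by_cases hs : s ∈ Set.Ioi (Real.log (1 - q))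
    · simp only [Set.indicator_of_mem hs]
    · simp only [Set.indicator_of_notMem hs, mul_zero]
  have hsurj : Set.Ioi (Real.log (1 - q)) = (fun t => Real.log (Rr σ q t)) '' Set.univ := by
    ext s
    simp only [Set.mem_Ioi, Set.image_univ, Set.mem_range]
    constructor
    · intro hs
      have hs' : 1 - q < Real.exp s := by rwa [Real.log_lt_iff_lt_exp (by linarith)] at hs
      refine ⟨gfun σ q s, ?_⟩
      have : (2 * gfun σ q s - 1) / (2 * σ ^ 2) = Real.log ((Real.exp s - (1 - q)) / q) := by
        unfold gfun; field_simp; ring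
      unfold Rr
      rw [this, Real.exp_log (div_pos (by linarith) hq0)]
      rw [mul_div_cancel₀ _ hq0.ne']
      ring_nf
      exact Real.log_exp s
    · rintro ⟨t, rfl⟩
      apply Real.log_lt_log (by linarith)
      unfold Rr
      have := mul_pos hq0 (Real.exp_pos ((2 * t - 1) / (2 * σ ^ 2))); linarith
  have hder : ∀ t : ℝ, HasDerivAt (fun t => Real.log (Rr σ q t))
      (q * Real.exp ((2 * t - 1) / (2 * σ ^ 2)) / σ ^ 2 / Rr σ q t) t := by
    intro t
    apply HasDerivAt.log _ (hR t).ne'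
    unfold Rr
    have a1 : HasDerivAt (fun t : ℝ => (2 * t - 1) / (2 * σ ^ 2)) (1 / σ ^ 2) t := by
      refine ((((hasDerivAt_id t).const_mul 2).sub_const 1).div_const (2 * σ ^ 2)).congr_deriv ?_
      field_simp
    refine ((a1.exp.const_mul q).const_add (1 - q)).congr_deriv ?_
    ring
  have hginv : ∀ t, gfun σ q (Real.log (Rr σ q t)) = t := by
    intro t
    unfold gfun
    rw [Real.exp_log (hR t)]
    have : (Rr σ q t - (1 - q)) / q = Real.exp ((2 * t - 1) / (2 * σ ^ 2)) := by
      unfold Rr; field_simp; ring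
    rw [this, Real.log_exp]; field_simp; ring
  rw [h1, hsurj, integral_image_eq_integral_abs_deriv_smul MeasurableSet.univ
    (fun x _ => (hder x).hasDerivWithinAt)
    (fun a _ b _ hab => by rw [← hginv a, ← hginv b]; exact congrArg _ hab)]
  rw [setIntegral_univ]
  congr 1; ext t
  have hE := Real.exp_pos ((2 * t - 1) / (2 * σ ^ 2))
  have hRt := hR t
  rw [hginv, abs_of_pos (by positivity), smul_eq_mul, Real.rpow_def_of_pos hRt]
  unfold gderiv
  rw [Real.exp_log hRt]
  have h5 : Rr σ q t - (1 - q) = q * Real.exp ((2 * t - 1) / (2 * σ ^ 2)) := by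
    unfold Rr; ring
  rw [h5, mul_comm lam]
  field_simp

lemma aux_pdf (σ a b t : ℝ) (hσ : 0 < σ) :
    ProbabilityTheory.gaussianPDFReal a (Real.toNNReal (σ ^ 2)) t
      = ProbabilityTheory.gaussianPDFReal b (Real.toNNReal (σ ^ 2)) t
        * Real.exp (((t - b) ^ 2 - (t - a) ^ 2) / (2 * σ ^ 2)) := by
  unfold ProbabilityTheory.gaussianPDFReal
  simp only [Real.coe_toNNReal _ (sq_nonneg σ)]
  have h : Real.exp (-(t - a) ^ 2 / (2 * σ ^ 2)) = Real.exp (-(t - b) ^ 2 / (2 * σ ^ 2)) *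
      Real.exp (((t - b) ^ 2 - (t - a) ^ 2) / (2 * σ ^ 2)) := by
    rw [← Real.exp_add]; congr 1; ring
  rw [h]; ring

lemma aux_ffun (σ q lam t : ℝ) (hq0 : 0 < q) (hq : q < 1) (hσ : 0 < σ) :
    ffun σ q t * (Rr σ q t) ^ lam =
      ProbabilityTheory.gaussianPDFReal 0 (Real.toNNReal (σ ^ 2)) t * (Rr σ q t) ^ (lam + 1) := by
  have hR : 0 < Rr σ q t := by
    unfold Rr; have := mul_pos hq0 (Real.exp_pos ((2 * t - 1) / (2 * σ ^ 2))); linarith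
  rw [Real.rpow_add_one hR.ne']
  have : ffun σ q t = ProbabilityTheory.gaussianPDFReal 0 (Real.toNNReal (σ ^ 2)) t * Rr σ q t := by
    unfold ffun Rr ProbabilityTheory.gaussianPDFReal
    simp only [Real.coe_toNNReal _ (sq_nonneg σ)]
    have : Real.exp (-(t - 1) ^ 2 / (2 * σ ^ 2)) =
      Real.exp (-t ^ 2 / (2 * σ ^ 2)) * Real.exp ((2 * t - 1) / (2 * σ ^ 2)) := by
      rw [← Real.exp_add]; congr 1; ring
    rw [this, sub_zero]; ring
  rw [this]; ring

lemma aux_tail (σ q lam c t : ℝ) (hq0 : 0 < q) (hq : q < 1) (hσ : 0 < σ) (hlam : 0 < lam)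
    (hz : lam + 1 ≤ σ ^ 2 * c + 1 / 2) (ht : σ ^ 2 * c + 1 / 2 ≤ t) :
    ProbabilityTheory.gaussianPDFReal 0 (Real.toNNReal (σ ^ 2)) t * (Rr σ q t) ^ (lam + 1) ≤
      (1 - q + q * Real.exp c) ^ (lam + 1) * Real.exp (-(σ ^ 2 * c ^ 2 / 2) - c / 2) *
      ProbabilityTheory.gaussianPDFReal (σ ^ 2 * c + 1 / 2) (Real.toNNReal (σ ^ 2)) t := by
  set z := σ ^ 2 * c + 1 / 2 with hzd
  have hR : 0 < Rr σ q t := by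
    unfold Rr; have := mul_pos hq0 (Real.exp_pos ((2 * t - 1) / (2 * σ ^ 2))); linarith
  have hR1 : 0 < 1 - q + q * Real.exp c := by
    have := mul_pos hq0 (Real.exp_pos c); linarith
  have hle : Rr σ q t ≤ (1 - q + q * Real.exp c) * Real.exp ((t - z) / σ ^ 2) := by
    have h1 : Real.exp ((2 * t - 1) / (2 * σ ^ 2)) = Real.exp c * Real.exp ((t - z) / σ ^ 2) := by
      rw [← Real.exp_add, hzd]; congr 1; field_simp; ring
    unfold Rr
    rw [h1]
    have h2 : 1 ≤ Real.exp ((t - z) / σ ^ 2) :=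
      Real.one_le_exp (div_nonneg (by linarith) (by positivity))
    nlinarith
  have hpow : (Rr σ q t) ^ (lam + 1) ≤
      (1 - q + q * Real.exp c) ^ (lam + 1) * Real.exp ((t - z) / σ ^ 2 * (lam + 1)) := by
    rw [Real.exp_mul, ← Real.mul_rpow hR1.le (Real.exp_pos _).le]
    exact Real.rpow_le_rpow hR.le hle (by linarith)
  rw [aux_pdf σ z 0 t hσ]
  have hp := ProbabilityTheory.gaussianPDFReal_nonneg 0 (Real.toNNReal (σ ^ 2)) t
  have hA : 0 < (1 - q + q * Real.exp c) ^ (lam + 1) := Real.rpow_pos_of_pos hR1 _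
  have hexp : Real.exp ((t - z) / σ ^ 2 * (lam + 1)) ≤
      Real.exp (-(σ ^ 2 * c ^ 2 / 2) - c / 2) *
        Real.exp (((t - 0) ^ 2 - (t - z) ^ 2) / (2 * σ ^ 2)) := by
    rw [← Real.exp_add]
    apply Real.exp_le_exp.2
    have h1 : (t - z) / σ ^ 2 * (lam + 1) ≤ (t - z) / σ ^ 2 * z := by
      exact mul_le_mul_of_nonneg_left hz (div_nonneg (by linarith) (by positivity))
    refine h1.trans ?_
    have h2 : -(σ ^ 2 * c ^ 2 / 2) - c / 2 + ((t - 0) ^ 2 - (t - z) ^ 2) / (2 * σ ^ 2)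
       = (t - z) / σ ^ 2 * z + 1 / (8 * σ ^ 2) := by
      rw [hzd]; field_simp; ring
    rw [h2]
    have : 0 < 1 / (8 * σ ^ 2) := by positivity
    linarith
  calc _ ≤ ProbabilityTheory.gaussianPDFReal 0 (Real.toNNReal (σ ^ 2)) t *
        ((1 - q + q * Real.exp c) ^ (lam + 1) * (Real.exp (-(σ ^ 2 * c ^ 2 / 2) - c / 2) *
        Real.exp (((t - 0) ^ 2 - (t - z) ^ 2) / (2 * σ ^ 2)))) := by
        gcongr
        exact hpow.trans (by gcongr)
    _ = _ := by ring

/-- moment generating function bound for the PLD of the Poisson-subsampled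
Gaussian mechanism: under the stated conditions on `λ`,
`∫ e^{λs} ω(s) ds ≤ 1 + 2q²(λ+1)λ/σ²`. -/
theorem pld_mgf_bound
    (σ q lam : ℝ) (hq0 : 0 < q) (hq : q ≤ 1 / 5) (hσ : 4 ≤ σ)
    (hlam1 : 1 < lam)
    (hlam2 : lam ≤ 1 / 2 * σ ^ 2 * Real.log (1 + 1 / (q * (lam - 1))) - 2 * Real.log σ)
    (hlam3 : lam ≤
      (1 / 2 * σ ^ 2 * Real.log (1 + 1 / (q * (lam - 1))) - Real.log 5 - 2 * Real.log σ) /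
        (Real.log (1 + 1 / (q * (lam - 1))) + Real.log (q * lam) + 1 / (2 * σ ^ 2))) :
    (∫ s, Real.exp (lam * s) * pld σ q s) ≤ 1 + 2 * q ^ 2 * (lam + 1) * lam / σ ^ 2 := by
  have hσ0 : 0 < σ := by linarith
  have hq1 : q < 1 := by linarith
  have hl1 : 0 < lam - 1 := by linarith
  have e1 := Real.exp_one_gt_d9
  have e2 := Real.exp_one_lt_d9
  have hnum := aux_num σ q lam _ _ hq0 hq hσ hlam1 rfl rfl hlam2
  have hlog : 1 ≤ Real.log σ := by
    rw [Real.le_log_iff_exp_le (by linarith)]; linarith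
  have hec : Real.exp (Real.log (1 + 1 / (q * (lam - 1)))) = 1 + 1 / (q * (lam - 1)) :=
    Real.exp_log (by positivity)
  clear hlam3
  generalize Real.log (1 + 1 / (q * (lam - 1))) = c at *
  set v : NNReal := (Real.toNNReal (σ ^ 2)) with hv
  have hv0 : v ≠ 0 := by
    exact (Real.toNNReal_pos.2 (by positivity)).ne'
  have hqc : 1 - q + q * Real.exp c = 1 + 1 / (lam - 1) := by
    rw [hec]; field_simp; ring
  set T := (1 - q + q * Real.exp c) ^ (lam + 1) * Real.exp (-(σ ^ 2 * c ^ 2 / 2) - c / 2) with hT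
  set M := Real.exp 1 / 2 * ((lam + 1) * lam) * q ^ 2 with hM
  let p : ℝ → ℝ → ℝ := fun a => ProbabilityTheory.gaussianPDFReal a v
  let G : ℝ → ℝ := fun t => (1 - (lam + 1) * q + M) * p 0 t + ((lam + 1) * q - 2 * M) * p 1 t
    + M * Real.exp (1 / σ ^ 2) * p 2 t + T * p (σ ^ 2 * c + 1 / 2) t
  have hpi : ∀ a, Integrable (p a) := fun a => ProbabilityTheory.integrable_gaussianPDFReal a v
  have hp1 : ∀ a, ∫ t, p a t = 1 := fun a =>
    ProbabilityTheory.integral_gaussianPDFReal_eq_one a hv0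
  have hR : ∀ t, 0 < Rr σ q t := fun t => by
    unfold Rr; have := mul_pos hq0 (Real.exp_pos ((2 * t - 1) / (2 * σ ^ 2))); linarith
  have hR1 : 0 < 1 - q + q * Real.exp c := by rw [hqc]; positivity
  have hT0 : 0 ≤ T := by positivity
  have i1 : Integrable (fun t => (1 - (lam + 1) * q + M) * p 0 t) := (hpi 0).const_mul _
  have i2 : Integrable (fun t => ((lam + 1) * q - 2 * M) * p 1 t) := (hpi 1).const_mul _
  have i3 : Integrable (fun t => M * Real.exp (1 / σ ^ 2) * p 2 t) := (hpi 2).const_mul _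
  have i4 : Integrable (fun t => T * p (σ ^ 2 * c + 1 / 2) t) := (hpi _).const_mul _
  have hGi : Integrable G := ((i1.add i2).add i3).add i4
  have hGint : ∫ t, G t = 1 + M * (Real.exp (1 / σ ^ 2) - 1) + T := by
    have : ∫ t, G t = (∫ t, (1 - (lam + 1) * q + M) * p 0 t)
      + (∫ t, ((lam + 1) * q - 2 * M) * p 1 t)
      + (∫ t, M * Real.exp (1 / σ ^ 2) * p 2 t) + (∫ t, T * p (σ ^ 2 * c + 1 / 2) t) := by
      have j1 := integral_add i1 i2
      have j2 := integral_add (i1.add i2) i3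
      have j3 := integral_add ((i1.add i2).add i3) i4
      simp only [Pi.add_apply] at j1 j2 j3
      rw [← j1, ← j2, ← j3]
    rw [this]
    simp only [integral_const_mul, hp1]
    ring
  have hpt : ∀ t, p 0 t * (Rr σ q t) ^ (lam + 1) ≤ G t := by
    intro t
    have hpn : ∀ a, 0 ≤ p a t := fun a => ProbabilityTheory.gaussianPDFReal_nonneg a v t
    have g1 : p 1 t = p 0 t * Real.exp ((2 * t - 1) / (2 * σ ^ 2)) := by
      simp only [p]
      rw [hv, aux_pdf σ 1 0 t hσ0]
      congr 2; ring
    have g2 : Real.exp (1 / σ ^ 2) * p 2 t = p 0 t * Real.exp ((2 * t - 1) / (2 * σ ^ 2)) ^ 2 := by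
      simp only [p]
      rw [hv, aux_pdf σ 2 0 t hσ0, ← Real.exp_nat_mul, mul_left_comm, ← Real.exp_add]
      congr 2; field_simp; push_cast; ring
    set E := Real.exp ((2 * t - 1) / (2 * σ ^ 2)) with hE
    have hRx : Rr σ q t = 1 + q * (E - 1) := by unfold Rr; ring
    have hG : G t = p 0 t * (1 + (lam + 1) * (q * (E - 1))
      + Real.exp 1 / 2 * ((lam + 1) * lam) * (q * (E - 1)) ^ 2)
      + T * p (σ ^ 2 * c + 1 / 2) t := by
      simp only [G]
      rw [mul_assoc M, g1, g2, hM]; ring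
    rw [hG]
    rcases le_or_gt t (σ ^ 2 * c + 1 / 2) with ht | ht
    · have hx : E ≤ 1 + 1 / (q * (lam - 1)) := by
        rw [← hec, hE]
        apply Real.exp_le_exp.2
        rw [div_le_iff₀ (by positivity)]; linarith
      have hx2 : q * (E - 1) * (lam - 1) ≤ 1 := by
        have : (E - 1) * (q * (lam - 1)) ≤ 1 := by
          rw [← le_div_iff₀ (by positivity)]; linarith
        linarith
      have := aux_taylor lam (q * (E - 1)) hlam1 (by linarith [hR t]) hx2
      rw [hRx]
      have h3 := mul_le_mul_of_nonneg_left this (hpn 0)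
      have h4 := mul_nonneg hT0 (hpn (σ ^ 2 * c + 1 / 2))
      linarith
    · have h3 := aux_tail σ q lam c t hq0 hq1 hσ0 (by linarith) (by linarith) ht.le
      have hx : 0 ≤ q * (E - 1) := by
        apply mul_nonneg hq0.le
        have : 1 ≤ E := by
          apply Real.one_le_exp
          apply div_nonneg _ (by positivity)
          linarith
        linarith
      have h4 : 0 ≤ p 0 t * (1 + (lam + 1) * (q * (E - 1))
        + Real.exp 1 / 2 * ((lam + 1) * lam) * (q * (E - 1)) ^ 2) := by
        apply mul_nonneg (hpn 0)
        positivity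
      have h5 : p 0 t * (Rr σ q t) ^ (lam + 1) ≤ T * p (σ ^ 2 * c + 1 / 2) t := h3
      linarith
  have hTb : T ≤ Real.exp 1 / 5 * (q ^ 2 * (lam + 1) * lam / σ ^ 2) := by
    have h1 : (1 - q + q * Real.exp c) ^ (lam + 1) ≤ Real.exp 1 * (lam / (lam - 1)) ^ 2 := by
      have h2 : lam + 1 = (lam - 1) + (2 : ℕ) := by push_cast; ring
      rw [h2, Real.rpow_add_natCast hR1.ne', hqc]
      have h3 : 1 + 1 / (lam - 1) = lam / (lam - 1) := by field_simp; ring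
      have h4 : (1 + 1 / (lam - 1)) ^ (lam - 1) ≤ Real.exp 1 := by
        calc (1 + 1 / (lam - 1)) ^ (lam - 1) ≤ (Real.exp (1 / (lam - 1))) ^ (lam - 1) := by
              apply Real.rpow_le_rpow (by positivity) _ hl1.le
              linarith [Real.add_one_le_exp (1 / (lam - 1))]
          _ = Real.exp (1 / (lam - 1) * (lam - 1)) := (Real.exp_mul _ _).symm
          _ = Real.exp 1 := by congr 1; field_simp
      calc _ ≤ Real.exp 1 * (1 + 1 / (lam - 1)) ^ 2 := by gcongr
        _ = _ := by rw [h3]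
    have h5 : Real.exp (-(σ ^ 2 * c ^ 2 / 2) - c / 2) ≤ 1 / 5 * (q * (lam - 1)) ^ 2 / σ ^ 2 := by
      rw [le_div_iff₀ (by positivity)]; linarith
    calc T ≤ (Real.exp 1 * (lam / (lam - 1)) ^ 2) * (1 / 5 * (q * (lam - 1)) ^ 2 / σ ^ 2) := by
          rw [hT]; gcongr
      _ = Real.exp 1 / 5 * (q ^ 2 * lam * lam / σ ^ 2) := by field_simp
      _ ≤ _ := by gcongr; linarith
  have hw : Real.exp (1 / σ ^ 2) - 1 ≤ 17 / 16 * (1 / σ ^ 2) := by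
    have hs16 : 16 ≤ σ ^ 2 := by nlinarith
    have hw1 : 1 / σ ^ 2 ≤ 1 / 16 := one_div_le_one_div_of_le (by norm_num) hs16
    have hw0 : 0 < 1 / σ ^ 2 := by positivity
    have := (abs_le.1 (Real.abs_exp_sub_one_sub_id_le (x := 1 / σ ^ 2)
      (by rw [abs_of_pos hw0]; linarith))).2
    nlinarith
  rw [aux_cov σ q lam hq0 hq1 hσ0]
  have hfin : ∫ t, ffun σ q t * (Rr σ q t) ^ lam ≤ ∫ t, G t := by
    apply integral_mono_of_nonneg
    · refine Filter.Eventually.of_forall fun t => ?_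
      have := hR t
      simp only [Pi.zero_apply]
      rw [aux_ffun σ q lam t hq0 hq1 hσ0]
      exact mul_nonneg (ProbabilityTheory.gaussianPDFReal_nonneg 0 v t) (by positivity)
    · exact hGi
    · refine Filter.Eventually.of_forall fun t => ?_
      simp only []
      rw [aux_ffun σ q lam t hq0 hq1 hσ0]
      exact hpt t
  refine hfin.trans ?_
  rw [hGint]
  have hMb : M * (Real.exp (1 / σ ^ 2) - 1) ≤ M * (17 / 16 * (1 / σ ^ 2)) := by
    gcongr
  have hS : 0 ≤ q ^ 2 * (lam + 1) * lam / σ ^ 2 := by positivity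
  have hM2 : M * (17 / 16 * (1 / σ ^ 2)) =
      Real.exp 1 * (17 / 32) * (q ^ 2 * (lam + 1) * lam / σ ^ 2) := by
    rw [hM]; ring
  have hS2 : 2 * q ^ 2 * (lam + 1) * lam / σ ^ 2 = 2 * (q ^ 2 * (lam + 1) * lam / σ ^ 2) := by ring
  rw [hS2]
  nlinarith
end

section
/- Let q ≤ 1/5, σ ≥ 4, L > 0, k ≥ 1, and let ω be the privacy loss distribution density of the Poisson-subsampled Gaussian mechanism. For every λ satisfying 1 < λ ≤ (1/2)σ²c − 2·log σ and λ ≤ ( (1/2)σ²c − log 5 − 2·log σ ) / ( c + log(qλ) + 1/(2σ²) ) with c = log(1 + 1/(q(λ − 1))), the tail of the k-fold self-convolution of ω satisfies ∫_L^∞ (ω *^k ω)(s) ds ≤ ( 1 + 2q²(λ + 1)λ/σ² )^k · e^{−Lλ}. In particular, if λ = L/2 satisfies these conditions, then ∫_L^∞ (ω *^k ω)(s) ds ≤ ( 1 + 2q²(L/2 + 1)(L/2)/σ² )^k · e^{−L²/2}. -/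
open MeasureTheory Real Set

/-- Convolution of two real functions. -/
noncomputable def conv (h₁ h₂ : ℝ → ℝ) : ℝ → ℝ := fun x => ∫ t, h₁ t * h₂ (x - t)

/-- `iterConv ω n` is the `(n+1)`-fold self-convolution of `ω`; `iterConv ω 0 = ω`. -/
noncomputable def iterConv (ω : ℝ → ℝ) : ℕ → (ℝ → ℝ)
  | 0 => ω
  | n + 1 => conv (iterConv ω n) ω

/-- Convolution truncated to `[-L, L]`. -/
noncomputable def tconv (L : ℝ) (h₁ h₂ : ℝ → ℝ) : ℝ → ℝ :=
  fun x => ∫ t in (-L)..L, h₁ t * h₂ (x - t)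

/-- `iterTConv L ω n` is the `(n+1)`-fold truncated self-convolution of `ω`;
`iterTConv L ω 0 = ω`. -/
noncomputable def iterTConv (L : ℝ) (ω : ℝ → ℝ) : ℕ → (ℝ → ℝ)
  | 0 => ω
  | n + 1 => tconv L (iterTConv L ω n) ω

/-- The `2L`-periodic extension of `ω` restricted to `[-L, L)`. -/
noncomputable def periodize (L : ℝ) (ω : ℝ → ℝ) : ℝ → ℝ :=
  fun t => ω (t - 2 * L * (⌊(t + L) / (2 * L)⌋ : ℝ))

/-- The conditions on `λ` from Theorem `thm:a_bound` (with `c = log(1 + 1/(q(λ−1)))`). -/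
def lamCond (σ q lam : ℝ) : Prop :=
  1 < lam ∧
  lam ≤ 1 / 2 * σ ^ 2 * Real.log (1 + 1 / (q * (lam - 1))) - 2 * Real.log σ ∧
  lam ≤
    (1 / 2 * σ ^ 2 * Real.log (1 + 1 / (q * (lam - 1))) - Real.log 5 - 2 * Real.log σ) /
      (Real.log (1 + 1 / (q * (lam - 1))) + Real.log (q * lam) + 1 / (2 * σ ^ 2))

section helpers

lemma aux_conv_eq (h₁ h₂ : ℝ → ℝ) :
    conv h₁ h₂ = MeasureTheory.convolution h₁ h₂ (ContinuousLinearMap.mul ℝ ℝ) volume := by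
  funext x
  simp [conv, MeasureTheory.convolution]

lemma aux_iter_tilt (ω : ℝ → ℝ) (l : ℝ) (n : ℕ) :
    iterConv (fun s => Real.exp (l * s) * ω s) n
      = fun x => Real.exp (l * x) * iterConv ω n x := by
  induction n with
  | zero => rfl
  | succ n ih =>
    funext x
    show (∫ t, iterConv (fun s => Real.exp (l * s) * ω s) n t
        * (Real.exp (l * (x - t)) * ω (x - t))) = Real.exp (l * x) * ∫ t, iterConv ω n t * ω (x - t)
    rw [ih, ← integral_const_mul]
    congr 1
    funext t
    have : Real.exp (l * x) = Real.exp (l * t) * Real.exp (l * (x - t)) := by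
      rw [← Real.exp_add]; congr 1; ring
    rw [this]; ring

lemma aux_iter_int (W : ℝ → ℝ) (hW : Integrable W) (n : ℕ) :
    Integrable (iterConv W n) ∧ ∫ x, iterConv W n x = (∫ x, W x) ^ (n + 1) := by
  induction n with
  | zero => exact ⟨hW, by simp [iterConv]⟩
  | succ n ih =>
    have e : iterConv W (n + 1) = conv (iterConv W n) W := rfl
    rw [e, aux_conv_eq]
    refine ⟨ih.1.integrable_convolution _ hW, ?_⟩
    rw [MeasureTheory.integral_convolution _ ih.1 hW, ih.2]
    simp [pow_succ]

lemma aux_iter_nonneg (ω : ℝ → ℝ) (h : ∀ s, 0 ≤ ω s) (n : ℕ) : ∀ s, 0 ≤ iterConv ω n s := by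
  induction n with
  | zero => exact h
  | succ n ih =>
    intro s
    exact integral_nonneg fun t => mul_nonneg (ih t) (h _)

lemma aux_chernoff (ω : ℝ → ℝ) (h : ∀ s, 0 ≤ ω s) (l L B : ℝ) (hl : 0 ≤ l)
    (hW : Integrable (fun s => Real.exp (l * s) * ω s))
    (hB : ∫ s, Real.exp (l * s) * ω s ≤ B) (n : ℕ) :
    ∫ s in Set.Ioi L, iterConv ω n s ≤ B ^ (n + 1) * Real.exp (-L * l) := by
  obtain ⟨hi, he⟩ := aux_iter_int _ hW n
  have hn := aux_iter_nonneg ω h n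
  have hnW := aux_iter_nonneg _ (fun s => mul_nonneg (Real.exp_pos (l * s)).le (h s)) n
  have h0 : 0 ≤ ∫ s, Real.exp (l * s) * ω s :=
    integral_nonneg fun s => mul_nonneg (Real.exp_pos (l * s)).le (h s)
  calc ∫ s in Set.Ioi L, iterConv ω n s
      ≤ ∫ s in Set.Ioi L, Real.exp (-L * l) *
          iterConv (fun s => Real.exp (l * s) * ω s) n s := by
        refine integral_mono_of_nonneg (ae_of_all _ hn) (hi.const_mul _).restrict ?_
        refine (ae_restrict_mem measurableSet_Ioi).mono fun s hs => ?_
        have hs' : L < s := hs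
        rw [aux_iter_tilt]
        show iterConv ω n s ≤ Real.exp (-L * l) * (Real.exp (l * s) * iterConv ω n s)
        rw [← mul_assoc, ← Real.exp_add]
        refine le_mul_of_one_le_left (hn s) (Real.one_le_exp ?_)
        nlinarith
    _ = Real.exp (-L * l) * ∫ s in Set.Ioi L, iterConv (fun s => Real.exp (l * s) * ω s) n s :=
        integral_const_mul _ _
    _ ≤ Real.exp (-L * l) * ∫ s, iterConv (fun s => Real.exp (l * s) * ω s) n s := by
        exact mul_le_mul_of_nonneg_left (setIntegral_le_integral hi (ae_of_all _ hnW))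
          (Real.exp_pos _).le
    _ ≤ B ^ (n + 1) * Real.exp (-L * l) := by
        rw [he, mul_comm]
        gcongr

/-- second order Taylor bound -/
lemma aux_taylor_s15 (a y : ℝ) (ha : 2 ≤ a) (hy : -1 < y) :
    (1 + y) ^ a ≤ 1 + a * y + a * (a - 1) / 2 * y ^ 2 * (max 1 (1 + y)) ^ (a - 2) := by
  have key : ∀ M : ℝ, ∀ z : ℝ, -1 < z → HasDerivAt
      (fun z : ℝ => 1 + a * z + a * (a - 1) / 2 * z ^ 2 * M - (1 + z) ^ a)
      (a * (1 + (a - 1) * M * z - (1 + z) ^ (a - 1))) z := by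
    intro M z hz
    have h1 : HasDerivAt (fun z : ℝ => (1 + z) ^ a) (1 * a * (1 + z) ^ (a - 1)) z :=
      ((hasDerivAt_id z).const_add 1).rpow_const (Or.inl (by simp; linarith))
    have h2 : HasDerivAt (fun z : ℝ => 1 + a * z + a * (a - 1) / 2 * z ^ 2 * M)
        (a * 1 + a * (a - 1) / 2 * (((2 : ℕ) : ℝ) * z ^ (2 - 1) * 1) * M) z :=
      (((hasDerivAt_id z).const_mul a).const_add 1).add
        ((((hasDerivAt_id z).pow 2).const_mul (a * (a - 1) / 2)).mul_const M)
    refine (h2.sub h1).congr_deriv ?_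
    push_cast
    ring
  rcases le_total 0 y with h0 | h0
  · rw [max_eq_right (by linarith)]
    set M := (1 + y) ^ (a - 2) with hM
    have hmono := monotoneOn_of_deriv_nonneg (convex_Icc 0 y)
      (f := fun z : ℝ => 1 + a * z + a * (a - 1) / 2 * z ^ 2 * M - (1 + z) ^ a)
      (fun z hz => (key M z (by linarith [hz.1])).continuousAt.continuousWithinAt)
      (fun z hz => by
        rw [interior_Icc] at hz
        exact (key M z (by linarith [hz.1])).differentiableAt.differentiableWithinAt)
      (fun z hz => by
        rw [interior_Icc] at hz
        obtain ⟨hz0, hzy⟩ := hz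
        rw [(key M z (by linarith)).deriv]
        have hp : 0 < 1 + z := by linarith
        have hb := one_add_mul_self_le_rpow_one_add (s := -z / (1 + z))
          (by rw [le_div_iff₀ hp]; linarith) (p := a - 1) (by linarith)
        have e1 : 1 + -z / (1 + z) = (1 + z)⁻¹ := by field_simp; ring
        rw [e1, Real.inv_rpow hp.le] at hb
        have hP : 0 < (1 + z) ^ (a - 1) := Real.rpow_pos_of_pos hp _
        have hPe : (1 + z) ^ (a - 1) = (1 + z) ^ (a - 2) * (1 + z) := by
          rw [← Real.rpow_add_one hp.ne']; congr 1; ring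
        have h3 : (1 + z) ^ (a - 2) ≤ M := Real.rpow_le_rpow hp.le (by linarith) (by linarith)
        have h4 := mul_le_mul_of_nonneg_left hb hP.le
        rw [mul_inv_cancel₀ hP.ne'] at h4
        have h5 : (1 + z) ^ (a - 1) * (1 + (a - 1) * (-z / (1 + z)))
            = (1 + z) ^ (a - 1) - (a - 1) * z * (1 + z) ^ (a - 2) := by
          rw [hPe]; field_simp; ring
        rw [h5] at h4
        have h6 : (a - 1) * z * (1 + z) ^ (a - 2) ≤ (a - 1) * z * M :=
          mul_le_mul_of_nonneg_left h3 (mul_nonneg (by linarith) hz0.le)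
        apply mul_nonneg (by linarith)
        nlinarith)
    have := hmono (left_mem_Icc.2 h0) (right_mem_Icc.2 h0) h0
    simp at this
    linarith
  · rw [max_eq_left (by linarith), Real.one_rpow]
    have hanti := antitoneOn_of_deriv_nonpos (convex_Icc y 0)
      (f := fun z : ℝ => 1 + a * z + a * (a - 1) / 2 * z ^ 2 * 1 - (1 + z) ^ a)
      (fun z hz => (key 1 z (by linarith [hz.1])).continuousAt.continuousWithinAt)
      (fun z hz => by
        rw [interior_Icc] at hz
        exact (key 1 z (by linarith [hz.1])).differentiableAt.differentiableWithinAt)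
      (fun z hz => by
        rw [interior_Icc] at hz
        obtain ⟨hz0, hzy⟩ := hz
        rw [(key 1 z (by linarith)).deriv]
        have hb := one_add_mul_self_le_rpow_one_add (s := z) (by linarith) (p := a - 1)
          (by linarith)
        apply mul_nonpos_of_nonneg_of_nonpos (by linarith)
        linarith)
    have := hanti (left_mem_Icc.2 h0) (right_mem_Icc.2 h0) h0
    simp at this
    linarith

lemma aux_max (q l c th X : ℝ) (hq0 : 0 < q) (hq : q ≤ 1) (hl : 1 < l) (hth : l - 1 ≤ th)
    (hc : q * (Real.exp c - 1) = 1 / (l - 1)) :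
    (max 1 (1 + q * (Real.exp X - 1))) ^ (l - 1)
      ≤ Real.exp 1 * (1 + Real.exp (th * (X - c))) := by
  have hl1 : 0 < l - 1 := by linarith
  have hexp : (Real.exp (1 / (l - 1))) ^ (l - 1) = Real.exp 1 := by
    rw [← Real.exp_mul]; congr 1; field_simp
  have hb : 1 + q * (Real.exp c - 1) ≤ Real.exp (1 / (l - 1)) := by
    rw [hc]; linarith [Real.add_one_le_exp (1 / (l - 1))]
  have hE := Real.exp_pos 1
  rcases le_total X c with h | h
  · have : max 1 (1 + q * (Real.exp X - 1)) ≤ Real.exp (1 / (l - 1)) := by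
      apply max_le (Real.one_le_exp (by positivity))
      have := Real.exp_le_exp.2 h
      nlinarith
    calc _ ≤ (Real.exp (1 / (l - 1))) ^ (l - 1) :=
          Real.rpow_le_rpow (by positivity) this hl1.le
      _ = Real.exp 1 := hexp
      _ ≤ _ := by nlinarith [Real.exp_pos (th * (X - c))]
  · have h1 : 1 ≤ Real.exp (X - c) := Real.one_le_exp (by linarith)
    have hXe : Real.exp X = Real.exp (X - c) * Real.exp c := by
      rw [← Real.exp_add]; congr 1; ring
    have h2 : 1 ≤ Real.exp (1 / (l - 1)) := Real.one_le_exp (by positivity)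
    have : max 1 (1 + q * (Real.exp X - 1)) ≤ Real.exp (1 / (l - 1)) * Real.exp (X - c) := by
      apply max_le (by nlinarith)
      rw [hXe]
      nlinarith [mul_le_mul_of_nonneg_left hb (by linarith : 0 ≤ Real.exp (X - c))]
    calc _ ≤ (Real.exp (1 / (l - 1)) * Real.exp (X - c)) ^ (l - 1) :=
          Real.rpow_le_rpow (by positivity) this hl1.le
      _ = Real.exp 1 * Real.exp ((X - c) * (l - 1)) := by
          rw [Real.mul_rpow (by positivity) (by positivity), hexp, ← Real.exp_mul]
      _ ≤ Real.exp 1 * Real.exp (th * (X - c)) := by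
          gcongr ?_ * Real.exp ?_
          nlinarith
      _ ≤ _ := by nlinarith

set_option maxHeartbeats 1000000 in
/-- the scalar inequality -/
lemma aux_scalar (σ q l c : ℝ) (hq0 : 0 < q) (hq : q ≤ 1 / 5) (hσ : 4 ≤ σ) (hl : 1 < l)
    (hc0 : 0 < c) (hc : q * (Real.exp c - 1) = 1 / (l - 1))
    (h1 : l ≤ 1 / 2 * σ ^ 2 * c - 2 * Real.log σ) :
    Real.exp 1 * ((Real.exp (1 / σ ^ 2) - 1) + Real.exp (-(σ ^ 2 * c ^ 2 / 2) - c / 2 - 1 / (8 * σ ^ 2))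
      * (Real.exp (2 * c + 2 / σ ^ 2) - 2 * Real.exp (c + 1 / (2 * σ ^ 2)) + 1)) ≤ 4 / σ ^ 2 := by
  set v := 1 / σ ^ 2 with hv
  have hs2 : 16 ≤ σ ^ 2 := by nlinarith
  have hv0 : 0 < v := by positivity
  have hv1 : v ≤ 1 / 16 := by
    rw [hv]; exact one_div_le_one_div_of_le (by norm_num) hs2
  have hsv : σ ^ 2 * v = 1 := by rw [hv]; field_simp
  have e1 : 1 / (8 * σ ^ 2) = v / 8 := by rw [hv]; field_simp
  have e2 : 2 / σ ^ 2 = 2 * v := by rw [hv]; field_simp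
  have e3 : 1 / (2 * σ ^ 2) = v / 2 := by rw [hv]; field_simp
  have e4 : 4 / σ ^ 2 = 4 * v := by rw [hv]; field_simp
  rw [e1, e2, e3, e4]
  set x := σ ^ 2 * c ^ 2 / 2 with hx
  have hlog : 1.38 ≤ Real.log σ := by
    have : Real.log 4 ≤ Real.log σ := Real.log_le_log (by norm_num) hσ
    have h4 : Real.log 4 = 2 * Real.log 2 := by
      rw [show (4 : ℝ) = 2 ^ 2 by norm_num, Real.log_pow]; norm_num
    linarith [Real.log_two_gt_d9]
  have hx8 : 8 * c ^ 2 ≤ x := by rw [hx]; nlinarith [sq_nonneg c]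
  have hxl : c * l + 2.76 * c ≤ x := by
    have := mul_le_mul_of_nonneg_left h1 hc0.le
    have h2 := mul_le_mul_of_nonneg_left hlog hc0.le
    rw [hx]; nlinarith
  have hec : 1 + c ≤ Real.exp c := by linarith [Real.add_one_le_exp c]
  have hx5 : 5 ≤ x := by
    rcases le_total 0.8 c with h | h
    · nlinarith
    · -- e^c bound
      have hh : Real.exp (c / 2) * (1 - c / 2) ≤ 1 := by
        have := Real.add_one_le_exp (-(c / 2))
        have h3 : Real.exp (c / 2) * Real.exp (-(c / 2)) = 1 := by
          rw [← Real.exp_add]; simp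
        nlinarith [Real.exp_pos (c / 2)]
      have hsq : Real.exp c = Real.exp (c / 2) ^ 2 := by
        rw [← Real.exp_nat_mul]; congr 1; push_cast; ring
      have hq2 : Real.exp c * (1 - c / 2) ^ 2 ≤ 1 := by
        rw [hsq, ← mul_pow]
        apply pow_le_one₀ _ hh
        have := Real.exp_pos (c / 2)
        apply mul_nonneg this.le; linarith
      have hE : (Real.exp c - 1) * (1 - 3 / 4 * c) ≤ c := by
        have h5 : (Real.exp c - 1) * (1 - c / 2) ^ 2 ≤ c * (1 - c / 4) := by nlinarith
        have h6 : (1 - 3 / 4 * c) * (1 - c / 4) ≤ (1 - c / 2) ^ 2 := by nlinarith [sq_nonneg c]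
        have h7 : (Real.exp c - 1) * ((1 - 3 / 4 * c) * (1 - c / 4)) ≤ c * (1 - c / 4) :=
          (mul_le_mul_of_nonneg_left h6 (by linarith)).trans h5
        have h8 : 0 < 1 - c / 4 := by linarith
        refine le_of_mul_le_mul_right ?_ h8
        linarith
      have hL : 5 ≤ (Real.exp c - 1) * (l - 1) := by
        have hl1 : 0 < l - 1 := by linarith
        have : q * ((Real.exp c - 1) * (l - 1)) = 1 := by
          rw [← mul_assoc, hc]; field_simp
        have hp : 0 < (Real.exp c - 1) * (l - 1) := mul_pos (by linarith) hl1
        nlinarith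
      have h9 : 5 * (1 - 3 / 4 * c) ≤ c * (l - 1) := by
        have hl1 : 0 < l - 1 := by linarith
        have := mul_le_mul_of_nonneg_right hE hl1.le
        have := mul_le_mul_of_nonneg_right hL (by linarith : 0 ≤ 1 - 3 / 4 * c)
        calc _ ≤ _ := this
          _ = (Real.exp c - 1) * (1 - 3 / 4 * c) * (l - 1) := by ring
          _ ≤ _ := by assumption
      linarith
  have h15 : 3 / 2 * c ≤ x / 4 := by
    have : (3 / 2 * c) ^ 2 ≤ (x / 4) ^ 2 := by nlinarith
    exact le_of_sq_le_sq this (by linarith)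
  have hexpv : Real.exp v - 1 ≤ 17 / 16 * v := by
    have := Real.abs_exp_sub_one_sub_id_le (x := v) (by rw [abs_of_pos hv0]; linarith)
    have := (abs_le.1 this).2
    nlinarith
  have hexp2v : Real.exp (2 * v) - 1 ≤ 9 / 4 * v := by
    have := Real.abs_exp_sub_one_sub_id_le (x := 2 * v) (by rw [abs_of_pos (by linarith)]; linarith)
    have := (abs_le.1 this).2
    nlinarith
  have hY : Real.exp (2 * c + 2 * v) - 2 * Real.exp (c + v / 2) + 1
      ≤ Real.exp (2 * c) * (c ^ 2 + 9 / 4 * v) := by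
    have a1 : Real.exp (2 * c + 2 * v) = Real.exp (2 * c) * Real.exp (2 * v) := Real.exp_add _ _
    have a2 : Real.exp c ≤ Real.exp (c + v / 2) := Real.exp_le_exp.2 (by linarith)
    have a3 : Real.exp (2 * c) = Real.exp c ^ 2 := by
      rw [← Real.exp_nat_mul]; norm_num
    have a4 : Real.exp c - 1 ≤ c * Real.exp c := by
      have := Real.add_one_le_exp (-c)
      have h3 : Real.exp c * Real.exp (-c) = 1 := by
        rw [← Real.exp_add]; simp
      nlinarith [Real.exp_pos c]
    have a5 : (Real.exp c - 1) ^ 2 ≤ (c * Real.exp c) ^ 2 := pow_le_pow_left₀ (by linarith) a4 2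
    rw [a1, a3]
    have a6 := mul_le_mul_of_nonneg_left hexp2v (sq_nonneg (Real.exp c))
    nlinarith
  have hZ : Real.exp (-x - c / 2 - v / 8)
      * (Real.exp (2 * c + 2 * v) - 2 * Real.exp (c + v / 2) + 1)
      ≤ Real.exp (-(3 / 4 * x)) * (2 * x + 9 / 4) * v := by
    calc _ ≤ Real.exp (-x - c / 2 - v / 8) * (Real.exp (2 * c) * (c ^ 2 + 9 / 4 * v)) := by gcongr
      _ = Real.exp (-x - c / 2 - v / 8 + 2 * c) * (c ^ 2 + 9 / 4 * v) := by
          rw [Real.exp_add]; ring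
      _ ≤ Real.exp (-(3 / 4 * x)) * (c ^ 2 + 9 / 4 * v) := by
          gcongr ?_ * _
          exact Real.exp_le_exp.2 (by linarith)
      _ = _ := by
          have : c ^ 2 = 2 * x * v := by
            rw [hx]; linear_combination (-c ^ 2) * hsv
          rw [this]; ring
  have hfin : Real.exp (-(3 / 4 * x)) * (2 * x + 9 / 4) ≤ 0.4 := by
    have b1 : Real.exp (3 / 4 * x) = Real.exp 3 * Real.exp (3 / 4 * x - 3) := by
      rw [← Real.exp_add]; congr 1; ring
    have b2 : (3 / 4 * x - 3) + 1 ≤ Real.exp (3 / 4 * x - 3) := Real.add_one_le_exp _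
    have b3 : 20 ≤ Real.exp 3 := by
      have : Real.exp 3 = Real.exp 1 ^ 3 := by rw [← Real.exp_nat_mul]; norm_num
      rw [this]
      calc (20 : ℝ) ≤ 2.7182818283 ^ 3 := by norm_num
        _ ≤ _ := pow_le_pow_left₀ (by norm_num) Real.exp_one_gt_d9.le 3
    have b4 : 20 * (3 / 4 * x - 2) ≤ Real.exp (3 / 4 * x) := by
      rw [b1]
      apply mul_le_mul b3 (by linarith) (by linarith) (Real.exp_pos _).le
    rw [Real.exp_neg, inv_mul_le_iff₀ (Real.exp_pos _)]
    linarith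
  have hE1 := Real.exp_one_lt_d9
  have hE0 := Real.exp_pos 1
  have hZ' : Real.exp (-x - c / 2 - v / 8)
      * (Real.exp (2 * c + 2 * v) - 2 * Real.exp (c + v / 2) + 1) ≤ 0.4 * v :=
    hZ.trans (mul_le_mul_of_nonneg_right hfin hv0.le)
  calc _ ≤ Real.exp 1 * (17 / 16 * v + 0.4 * v) := by gcongr
    _ ≤ _ := by nlinarith

end helpers

section helpers2

/-- Gaussian density with variance `σ²`. -/
noncomputable def auxG (σ m t : ℝ) : ℝ :=
  (1 / Real.sqrt (2 * Real.pi * σ ^ 2)) * Real.exp (-(t - m) ^ 2 / (2 * σ ^ 2))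

lemma auxG_eq (σ m : ℝ) :
    auxG σ m = ProbabilityTheory.gaussianPDFReal m ⟨σ ^ 2, sq_nonneg σ⟩ := by
  funext t
  unfold auxG ProbabilityTheory.gaussianPDFReal
  rw [one_div]
  rfl

lemma auxG_integrable (σ m : ℝ) : Integrable (auxG σ m) := by
  rw [auxG_eq]; exact ProbabilityTheory.integrable_gaussianPDFReal _ _

lemma auxG_integral (σ m : ℝ) (h : σ ≠ 0) : ∫ t, auxG σ m t = 1 := by
  rw [auxG_eq]
  apply ProbabilityTheory.integral_gaussianPDFReal_eq_one
  intro h0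
  have := congrArg NNReal.toReal h0
  have h2 : σ ^ 2 = 0 := this
  exact h (pow_eq_zero_iff (two_ne_zero) |>.1 h2)

lemma auxG_tilt (σ m t : ℝ) (h : σ ≠ 0) :
    auxG σ 0 t * Real.exp (m * ((t - 1 / 2) / σ ^ 2))
      = Real.exp (m * (m - 1) / (2 * σ ^ 2)) * auxG σ m t := by
  unfold auxG
  have : Real.exp (-(t - 0) ^ 2 / (2 * σ ^ 2)) * Real.exp (m * ((t - 1 / 2) / σ ^ 2))
      = Real.exp (m * (m - 1) / (2 * σ ^ 2)) * Real.exp (-(t - m) ^ 2 / (2 * σ ^ 2)) := by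
    rw [← Real.exp_add, ← Real.exp_add]
    congr 1
    field_simp
    ring
  linear_combination (1 / Real.sqrt (2 * Real.pi * σ ^ 2)) * this

lemma aux_ffun_s15 (σ q t : ℝ) (h : σ ≠ 0) :
    ffun σ q t = auxG σ 0 t * (1 + q * (Real.exp ((t - 1 / 2) / σ ^ 2) - 1)) := by
  have h1 := auxG_tilt σ 1 t h
  simp only [one_mul, sub_self, mul_zero, zero_div, Real.exp_zero] at h1
  have h2 : ffun σ q t = q * auxG σ 1 t + (1 - q) * auxG σ 0 t := by
    unfold ffun auxG; rw [sub_zero]; ring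
  rw [h2, ← h1]; ring

/-- the tilted integrand in the `t` variable -/
noncomputable def auxF (σ q l t : ℝ) : ℝ :=
  auxG σ 0 t * (1 + q * (Real.exp ((t - 1 / 2) / σ ^ 2) - 1)) ^ (l + 1)

lemma auxG_nonneg (σ m t : ℝ) : 0 ≤ auxG σ m t := by unfold auxG; positivity

lemma auxF_bound (σ q l : ℝ) (hq0 : 0 < q) (hq : q ≤ 1 / 5) (hσ : 4 ≤ σ)
    (h : lamCond σ q l) :
    Integrable (auxF σ q l) ∧ ∫ t, auxF σ q l t ≤ 1 + 2 * q ^ 2 * (l + 1) * l / σ ^ 2 := by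
  obtain ⟨hl, h1, -⟩ := h
  have hσ0 : σ ≠ 0 := by linarith
  have hl1 : 0 < l - 1 := by linarith
  set c := Real.log (1 + 1 / (q * (l - 1))) with hcdef
  have hr : 0 < 1 / (q * (l - 1)) := by positivity
  have hec : Real.exp c = 1 + 1 / (q * (l - 1)) := Real.exp_log (by linarith)
  have hc0 : 0 < c := Real.log_pos (by linarith)
  have hc : q * (Real.exp c - 1) = 1 / (l - 1) := by
    rw [hec]; field_simp; ring
  set th := σ ^ 2 * c + 1 / 2 with hth
  have hlog : 0 ≤ Real.log σ := Real.log_nonneg (by linarith)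
  have hsc : 0 ≤ σ ^ 2 * c := by positivity
  have hthl : l - 1 ≤ th := by rw [hth]; linarith
  set K := (l + 1) * l / 2 * q ^ 2 * Real.exp 1 with hK
  have hK0 : 0 ≤ K := by
    have : 0 < l := by linarith
    positivity
  set E : ℝ → ℝ := fun m => Real.exp (m * (m - 1) / (2 * σ ^ 2)) with hE
  set H : ℝ → ℝ := fun t =>
    (1 - (l + 1) * q + K) * auxG σ 0 t + ((l + 1) * q - 2 * K) * auxG σ 1 t
      + K * E 2 * auxG σ 2 t + K * Real.exp (-(th * c)) * E th * auxG σ th t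
      + (-2 * K * Real.exp (-(th * c)) * E (th + 1)) * auxG σ (th + 1) t
      + K * Real.exp (-(th * c)) * E (th + 2) * auxG σ (th + 2) t with hH
  have hi := auxG_integrable σ
  have hHi : Integrable H := by
    exact (((((hi 0).const_mul _).add ((hi 1).const_mul _)).add ((hi 2).const_mul _)).add
      ((hi th).const_mul _)).add ((hi (th + 1)).const_mul _) |>.add ((hi (th + 2)).const_mul _)
  have hHint : ∫ t, H t = (1 - (l + 1) * q + K) + ((l + 1) * q - 2 * K)
      + K * E 2 + K * Real.exp (-(th * c)) * E th
      + (-2 * K * Real.exp (-(th * c)) * E (th + 1))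
      + K * Real.exp (-(th * c)) * E (th + 2) := by
    have hI := fun m => auxG_integral σ m hσ0
    have i0 := fun (a m : ℝ) => (hi m).const_mul a
    simp only [hH]
    rw [integral_add (by fun_prop) (by fun_prop), integral_add (by fun_prop) (by fun_prop),
      integral_add (by fun_prop) (by fun_prop), integral_add (by fun_prop) (by fun_prop),
      integral_add (by fun_prop) (by fun_prop)]
    simp only [integral_const_mul, hI, mul_one]
  have hpos : ∀ t, 0 < 1 + q * (Real.exp ((t - 1 / 2) / σ ^ 2) - 1) := fun t => by
    nlinarith [Real.exp_pos ((t - 1 / 2) / σ ^ 2)]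
  have hF0 : ∀ t, 0 ≤ auxF σ q l t := fun t =>
    mul_nonneg (auxG_nonneg _ _ _) (Real.rpow_nonneg (hpos t).le _)
  have hFH : ∀ t, auxF σ q l t ≤ H t := by
    intro t
    have tl := fun m => auxG_tilt σ m t hσ0
    set X := (t - 1 / 2) / σ ^ 2 with hX
    have ty := aux_taylor_s15 (l + 1) (q * (Real.exp X - 1)) (by linarith)
      (by linarith [hpos t])
    have mx := aux_max q l c th X hq0 (by linarith) hl hthl hc
    have e1 : l + 1 - 2 = l - 1 := by ring
    have e2 : l + 1 - 1 = l := by ring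
    rw [e1, e2] at ty
    have hcoef : 0 ≤ (l + 1) * l / 2 * (q * (Real.exp X - 1)) ^ 2 := by
      have : 0 < l := by linarith
      positivity
    have b1 := ty.trans (add_le_add_right (mul_le_mul_of_nonneg_left mx hcoef) _)
    have b2 := mul_le_mul_of_nonneg_left b1 (auxG_nonneg σ 0 t)
    refine b2.trans (le_of_eq ?_)
    have t1 := tl 1
    have t2 := tl 2
    have t3 := tl th
    have t4 := tl (th + 1)
    have t5 := tl (th + 2)
    have x2 : Real.exp (2 * X) = Real.exp X ^ 2 := by rw [← Real.exp_nat_mul]; norm_num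
    have x4 : Real.exp ((th + 1) * X) = Real.exp (th * X) * Real.exp X := by
      rw [← Real.exp_add]; congr 1; ring
    have x5 : Real.exp ((th + 2) * X) = Real.exp (th * X) * Real.exp X ^ 2 := by
      rw [← x2, ← Real.exp_add]; congr 1; ring
    have x6 : Real.exp (th * (X - c)) = Real.exp (-(th * c)) * Real.exp (th * X) := by
      rw [← Real.exp_add]; congr 1; ring
    rw [one_mul, sub_self, mul_zero, zero_div, Real.exp_zero, one_mul] at t1
    rw [x2] at t2
    rw [x4] at t4
    rw [x5] at t5
    simp only [hH, hE]
    rw [x6, hK]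
    set D := (l + 1) * l / 2 * q ^ 2 * Real.exp 1
    linear_combination ((l + 1) * q - 2 * K) * t1 + K * t2
      + K * Real.exp (-(th * c)) * t3 - 2 * K * Real.exp (-(th * c)) * t4
      + K * Real.exp (-(th * c)) * t5
  have hmeas : AEStronglyMeasurable (auxF σ q l) volume := by
    apply Measurable.aestronglyMeasurable
    unfold auxF auxG
    fun_prop
  refine ⟨hHi.mono' hmeas (ae_of_all _ fun t => by
    rw [Real.norm_of_nonneg (hF0 t)]; exact hFH t), ?_⟩
  refine (integral_mono_of_nonneg (ae_of_all _ hF0) hHi (ae_of_all _ hFH)).trans ?_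
  rw [hHint]
  have sc := aux_scalar σ q l c hq0 hq hσ hl hc0 hc h1
  have y2 : E 2 = Real.exp (1 / σ ^ 2) := by
    simp only [hE]; congr 1; field_simp; ring
  have hs : σ ^ 2 * (1 / σ ^ 2) = 1 := by field_simp
  have y3 : Real.exp (-(th * c)) * E th
      = Real.exp (-(σ ^ 2 * c ^ 2 / 2) - c / 2 - 1 / (8 * σ ^ 2)) := by
    simp only [hE]; rw [← Real.exp_add]; congr 1; rw [hth]; field_simp; ring
  have y4 : Real.exp (-(th * c)) * E (th + 1)
      = Real.exp (-(σ ^ 2 * c ^ 2 / 2) - c / 2 - 1 / (8 * σ ^ 2))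
        * Real.exp (c + 1 / (2 * σ ^ 2)) := by
    simp only [hE]; rw [← Real.exp_add, ← Real.exp_add]; congr 1; rw [hth]; field_simp; ring
  have y5 : Real.exp (-(th * c)) * E (th + 2)
      = Real.exp (-(σ ^ 2 * c ^ 2 / 2) - c / 2 - 1 / (8 * σ ^ 2))
        * Real.exp (2 * c + 2 / σ ^ 2) := by
    simp only [hE]; rw [← Real.exp_add, ← Real.exp_add]; congr 1; rw [hth]; field_simp; ring
  have hk : 0 ≤ (l + 1) * l / 2 * q ^ 2 := by
    have : 0 < l := by linarith
    positivity
  have sc2 := mul_le_mul_of_nonneg_left sc hk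
  have ee : (l + 1) * l / 2 * q ^ 2 * (4 / σ ^ 2) = 2 * q ^ 2 * (l + 1) * l / σ ^ 2 := by
    field_simp; ring
  rw [ee] at sc2
  rw [y2]
  refine le_trans (le_of_eq ?_) (add_le_add_right sc2 1)
  linear_combination K * y3 - 2 * K * y4 + K * y5

lemma aux_pld (σ q l : ℝ) (hq0 : 0 < q) (hq : q ≤ 1 / 5) (hσ : 4 ≤ σ)
    (hF : Integrable (auxF σ q l)) :
    Integrable (fun s => Real.exp (l * s) * pld σ q s) ∧
      ∫ s, Real.exp (l * s) * pld σ q s = ∫ t, auxF σ q l t := by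
  have hσ0 : σ ≠ 0 := by linarith
  set S := Set.Ioi (Real.log (1 - q)) with hS
  have hq1 : 0 < 1 - q := by linarith
  have hpos : ∀ s ∈ S, 0 < Real.exp s - (1 - q) := by
    intro s hs
    have := (Real.log_lt_iff_lt_exp hq1).1 hs
    linarith
  have hder : ∀ s ∈ S, HasDerivWithinAt (gfun σ q) (gderiv σ q s) S s := by
    intro s hs
    have hp := hpos s hs
    have h1 : HasDerivAt (fun s => (Real.exp s - (1 - q)) / q) (Real.exp s / q) s :=
      ((Real.hasDerivAt_exp s).sub_const _).div_const _
    have h2 := ((h1.log (by positivity)).const_mul (σ ^ 2)).add_const (1 / 2)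
    refine (h2.congr_deriv ?_).hasDerivWithinAt
    unfold gderiv; field_simp
  have hinv : ∀ s ∈ S, 1 + q * (Real.exp ((gfun σ q s - 1 / 2) / σ ^ 2) - 1) = Real.exp s := by
    intro s hs
    have hp := hpos s hs
    have : (gfun σ q s - 1 / 2) / σ ^ 2 = Real.log ((Real.exp s - (1 - q)) / q) := by
      unfold gfun; field_simp; ring
    rw [this, Real.exp_log (by positivity)]; field_simp; ring
  have hinj : Set.InjOn (gfun σ q) S := by
    intro a ha b hb hab
    have h1 := hinv a ha
    rw [hab, hinv b hb] at h1
    exact (Real.exp_injective h1).symm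
  have himg : gfun σ q '' S = Set.univ := by
    rw [Set.eq_univ_iff_forall]
    intro t
    have he := Real.exp_pos ((t - 1 / 2) / σ ^ 2)
    have hp : 0 < 1 - q + q * Real.exp ((t - 1 / 2) / σ ^ 2) := by positivity
    refine ⟨Real.log (1 - q + q * Real.exp ((t - 1 / 2) / σ ^ 2)), ?_, ?_⟩
    · apply Real.log_lt_log hq1
      have : 0 < q * Real.exp ((t - 1 / 2) / σ ^ 2) := by positivity
      linarith
    · unfold gfun
      rw [Real.exp_log hp]
      have : (1 - q + q * Real.exp ((t - 1 / 2) / σ ^ 2) - (1 - q)) / q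
          = Real.exp ((t - 1 / 2) / σ ^ 2) := by field_simp; ring
      rw [this, Real.log_exp]; field_simp; ring
  have hcv := MeasureTheory.integral_image_eq_integral_abs_deriv_smul measurableSet_Ioi hder hinj
    (auxF σ q l)
  have hci := MeasureTheory.integrableOn_image_iff_integrableOn_abs_deriv_smul measurableSet_Ioi
    hder hinj (auxF σ q l)
  have heq : ∀ s ∈ S, |gderiv σ q s| • auxF σ q l (gfun σ q s)
      = Real.exp (l * s) * (ffun σ q (gfun σ q s) * gderiv σ q s) := by
    intro s hs
    have hp := hpos s hs
    have hg : 0 ≤ gderiv σ q s := by unfold gderiv; positivity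
    rw [abs_of_nonneg hg, smul_eq_mul, aux_ffun_s15 _ _ _ hσ0]
    unfold auxF
    rw [hinv s hs, Real.rpow_add_one (Real.exp_pos s).ne', ← Real.exp_mul, mul_comm s l]
    ring
  have hind : (fun s => Real.exp (l * s) * pld σ q s)
      = S.indicator (fun s => Real.exp (l * s) * (ffun σ q (gfun σ q s) * gderiv σ q s)) := by
    funext s
    unfold pld
    by_cases hs : s ∈ S
    · rw [Set.indicator_of_mem hs, Set.indicator_of_mem hs]
    · rw [Set.indicator_of_notMem hs, Set.indicator_of_notMem hs, mul_zero]
  constructor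
  · rw [hind, integrable_indicator_iff measurableSet_Ioi]
    rw [himg, integrableOn_univ] at hci
    exact (hci.1 hF).congr_fun heq measurableSet_Ioi
  · rw [hind, integral_indicator measurableSet_Ioi]
    rw [himg, setIntegral_univ] at hcv
    rw [hcv]
    exact (setIntegral_congr_fun measurableSet_Ioi heq).symm

lemma aux_pld_nonneg (σ q : ℝ) (hq0 : 0 < q) (hq : q ≤ 1 / 5) : ∀ s, 0 ≤ pld σ q s := by
  intro s
  unfold pld
  apply Set.indicator_nonneg
  intro s hs
  have hq1 : 0 < 1 - q := by linarith
  have := (Real.log_lt_iff_lt_exp hq1).1 hs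
  have hp : 0 < Real.exp s - (1 - q) := by linarith
  unfold ffun gderiv
  positivity

end helpers2

/-- analytic tail bound for the `k`-fold self-convolution of the PLD of the
Poisson-subsampled Gaussian mechanism, and its specialisation to `λ = L/2`. -/
theorem pld_convolution_tail_bound
    (σ q L : ℝ) (hq0 : 0 < q) (hq : q ≤ 1 / 5) (hσ : 4 ≤ σ) (hL : 0 < L)
    (k : ℕ) (hk : 1 ≤ k) :
    (∀ lam : ℝ, lamCond σ q lam →
      (∫ s in Set.Ioi L, iterConv (pld σ q) (k - 1) s) ≤
        (1 + 2 * q ^ 2 * (lam + 1) * lam / σ ^ 2) ^ k * Real.exp (-L * lam)) ∧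
    (lamCond σ q (L / 2) →
      (∫ s in Set.Ioi L, iterConv (pld σ q) (k - 1) s) ≤
        (1 + 2 * q ^ 2 * (L / 2 + 1) * (L / 2) / σ ^ 2) ^ k * Real.exp (-L ^ 2 / 2)) := by
  have main : ∀ lam : ℝ, lamCond σ q lam →
      (∫ s in Set.Ioi L, iterConv (pld σ q) (k - 1) s) ≤
        (1 + 2 * q ^ 2 * (lam + 1) * lam / σ ^ 2) ^ k * Real.exp (-L * lam) := by
    intro lam hlam
    obtain ⟨hF, hB⟩ := auxF_bound σ q lam hq0 hq hσ hlam
    obtain ⟨hW, hI⟩ := aux_pld σ q lam hq0 hq hσ hF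
    have := aux_chernoff (pld σ q) (aux_pld_nonneg σ q hq0 hq) lam L _
      (by linarith [hlam.1]) hW (hI.le.trans hB) (k - 1)
    rwa [Nat.sub_add_cancel hk] at this
  refine ⟨main, fun h => ?_⟩
  have := main (L / 2) h
  rwa [show -L * (L / 2) = -L ^ 2 / 2 by ring] at this
end

section
/- Let σ ≥ 1 and 0 < q < 1, and let ω be the privacy loss distribution density of the Poisson-subsampled Gaussian mechanism. Then for all s ∈ (log(1−q), ∞), the first and second derivatives of ω satisfy |ω'(s)| ≤ 4·e^{3/σ²}·σ³/q² and |ω''(s)| ≤ 11·e^{9/(2σ²)}·σ³/q³. -/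
open MeasureTheory Real Set

lemma aux_t (t : ℝ) : |t| * exp (-t ^ 2 / 2) ≤ 0.708 := by
  have h1 : 1 + t ^ 2 / 2 ≤ exp (t ^ 2 / 2) := by linarith [add_one_le_exp (t ^ 2 / 2)]
  have h2 : |t| ≤ 0.708 * exp (t ^ 2 / 2) := by
    rw [← sq_abs] at h1 ⊢
    nlinarith [sq_nonneg (|t| - 1.4142)]
  have h3 : exp (-t ^ 2 / 2) * exp (t ^ 2 / 2) = 1 := by
    rw [← exp_add, ← exp_zero]; congr 1; ring
  nlinarith [exp_pos (-t ^ 2 / 2)]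

lemma aux_t2 (t : ℝ) : t ^ 2 * exp (-t ^ 2 / 2) ≤ 0.736 := by
  have h1 : t ^ 2 / 2 ≤ exp (t ^ 2 / 2 - 1) := by linarith [add_one_le_exp (t ^ 2 / 2 - 1)]
  have h4 : exp 1 * exp (t ^ 2 / 2 - 1) = exp (t ^ 2 / 2) := by
    rw [← exp_add]; congr 1; ring
  have h5 := exp_one_gt_d9
  have h2 : t ^ 2 ≤ 0.736 * exp (t ^ 2 / 2) := by
    nlinarith [exp_pos (t ^ 2 / 2 - 1)]
  have h3 : exp (-t ^ 2 / 2) * exp (t ^ 2 / 2) = 1 := by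
    rw [← exp_add, ← exp_zero]; congr 1; ring
  nlinarith [exp_pos (-t ^ 2 / 2)]

lemma aux_e (t : ℝ) : exp (-t ^ 2 / 2) ≤ 1 := by
  rw [exp_le_one_iff]; nlinarith [sq_nonneg t]

lemma aux_15 (x : ℝ) (hx : x ≤ 1) : exp (1.5 * x) ≤ 4.49 := by
  have h1 : exp (1.5 * x) ≤ exp 1.5 := exp_le_exp.2 (by linarith)
  have h2 : exp 1.5 ^ 2 = exp 1 ^ 3 := by
    rw [← exp_nat_mul, ← exp_nat_mul]; norm_num
  have h3 : exp 1 ^ 3 ≤ 2.7182818286 ^ 3 := by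
    gcongr; exact exp_one_lt_d9.le
  have : exp 1.5 ≤ 4.49 := by
    by_contra h
    push Not at h
    nlinarith
  linarith

/-- core, low case -/
lemma low_bounds (a ρ : ℝ) (h0 : 0 < ρ) (h1 : ρ ≤ 1) :
    ρ ^ 2 * exp (-a ^ 2 / 2 - 3 * (ρ * a) / 2 - ρ ^ 2 / 8) ≤ 2 / 7 * exp (9 / 2 * ρ ^ 2) ∧
    ρ ^ 2 * exp (-a ^ 2 / 2 - 3 * (ρ * a) / 2 - ρ ^ 2 / 8) ≤ exp (3 * ρ ^ 2) ∧
    ρ * |a + 1.5 * ρ| * exp (-a ^ 2 / 2 - 5 * (ρ * a) / 2 - ρ ^ 2 / 8)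
      ≤ (0.708 + ρ ^ 2) * exp (3 * ρ ^ 2) ∧
    ρ * |a + 1.5 * ρ| * exp (-a ^ 2 / 2 - 5 * (ρ * a) / 2 - ρ ^ 2 / 8)
      ≤ 1.375 * exp (9 / 2 * ρ ^ 2) ∧
    |(a + 1.5 * ρ) ^ 2 + ρ * (a + 1.5 * ρ) - 1| *
      exp (-a ^ 2 / 2 - 7 * (ρ * a) / 2 - ρ ^ 2 / 8) ≤ 17.34 * exp (9 / 2 * ρ ^ 2) := by
  have hr2 : ρ ^ 2 ≤ 1 := by nlinarith
  have hr0 : 0 < ρ ^ 2 := by positivity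
  have e1 : exp (-a ^ 2 / 2 - 3 * (ρ * a) / 2 - ρ ^ 2 / 8) ≤ exp (ρ ^ 2) := by
    rw [exp_le_exp]; nlinarith [sq_nonneg (a + 1.5 * ρ)]
  have key3 : ρ * |a + 1.5 * ρ| * exp (-a ^ 2 / 2 - 5 * (ρ * a) / 2 - ρ ^ 2 / 8)
      ≤ (0.708 + ρ ^ 2) * exp (3 * ρ ^ 2) := by
    have e2 : exp (-a ^ 2 / 2 - 5 * (ρ * a) / 2 - ρ ^ 2 / 8)
        = exp (-(a + 2.5 * ρ) ^ 2 / 2) * exp (3 * ρ ^ 2) := by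
      rw [← exp_add]; congr 1; ring
    rw [e2, ← mul_assoc]
    gcongr
    set b := a + 2.5 * ρ with hb
    have : |a + 1.5 * ρ| ≤ |b| + ρ := by
      have : a + 1.5 * ρ = b - ρ := by rw [hb]; ring
      rw [this]
      exact (abs_sub _ _).trans (by rw [abs_of_pos h0])
    have t1 := aux_t b
    have t2 := aux_e b
    have p := exp_pos (-b ^ 2 / 2)
    calc ρ * |a + 1.5 * ρ| * exp (-b ^ 2 / 2) ≤ ρ * (|b| + ρ) * exp (-b ^ 2 / 2) := by gcongr
      _ = ρ * (|b| * exp (-b ^ 2 / 2)) + ρ ^ 2 * exp (-b ^ 2 / 2) := by ring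
      _ ≤ 1 * 0.708 + ρ ^ 2 * 1 := by gcongr
      _ = _ := by ring
  refine ⟨?_, ?_, key3, ?_, ?_⟩
  · have : exp (9 / 2 * ρ ^ 2) = exp (3.5 * ρ ^ 2) * exp (ρ ^ 2) := by
      rw [← exp_add]; congr 1; ring
    rw [this, ← mul_assoc (2 / 7)]
    have := add_one_le_exp (3.5 * ρ ^ 2)
    have : ρ ^ 2 ≤ 2 / 7 * exp (3.5 * ρ ^ 2) := by linarith
    exact mul_le_mul this e1 (exp_pos _).le (by positivity : 0 ≤ 2 / 7 * exp (3.5 * ρ ^ 2))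
  · have : exp (ρ ^ 2) ≤ exp (3 * ρ ^ 2) := by rw [exp_le_exp]; linarith
    nlinarith [exp_pos (-a ^ 2 / 2 - 3 * (ρ * a) / 2 - ρ ^ 2 / 8)]
  · refine key3.trans ?_
    have : exp (9 / 2 * ρ ^ 2) = exp (1.5 * ρ ^ 2) * exp (3 * ρ ^ 2) := by
      rw [← exp_add]; congr 1; ring
    rw [this, ← mul_assoc]
    have := add_one_le_exp (1.5 * ρ ^ 2)
    gcongr
    linarith
  · have e2 : exp (-a ^ 2 / 2 - 7 * (ρ * a) / 2 - ρ ^ 2 / 8)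
        = exp (-(a + 3.5 * ρ) ^ 2 / 2) * exp (1.5 * ρ ^ 2) * exp (9 / 2 * ρ ^ 2) := by
      rw [← exp_add, ← exp_add]; congr 1; ring
    rw [e2, ← mul_assoc, ← mul_assoc]
    gcongr
    set c := a + 3.5 * ρ with hc
    have : |(a + 1.5 * ρ) ^ 2 + ρ * (a + 1.5 * ρ) - 1| ≤ c ^ 2 + 3 * |c| + 1 := by
      have : (a + 1.5 * ρ) ^ 2 + ρ * (a + 1.5 * ρ) - 1 = c ^ 2 - 3 * (ρ * c) + 2 * ρ ^ 2 - 1 := by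
        rw [hc]; ring
      rw [this]
      have h3 : |ρ * c| ≤ |c| := by
        rw [abs_mul, abs_of_pos h0]; nlinarith [abs_nonneg c]
      have := abs_le.1 h3
      rw [abs_le]
      constructor <;> nlinarith [sq_nonneg c]
    have t1 := aux_t c
    have t2 := aux_e c
    have t3 := aux_t2 c
    have h15 := aux_15 _ hr2
    have p := exp_pos (-c ^ 2 / 2)
    calc |(a + 1.5 * ρ) ^ 2 + ρ * (a + 1.5 * ρ) - 1| * exp (-c ^ 2 / 2) * exp (1.5 * ρ ^ 2)
        ≤ (c ^ 2 + 3 * |c| + 1) * exp (-c ^ 2 / 2) * 4.49 := by gcongr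
      _ ≤ 17.34 := by nlinarith

lemma high_bounds (a ρ : ℝ) (ha : 0 ≤ a) (h0 : 0 < ρ) (h1 : ρ ≤ 1) :
    (2 * ρ ^ 2 + ρ * |a + 1.5 * ρ|) * exp (-a ^ 2 / 2 + (ρ * a) / 2 - ρ ^ 2 / 8) ≤ 10 ∧
    (4 * ρ ^ 2 + 5 * (ρ * |a + 1.5 * ρ|) + |(a + 1.5 * ρ) ^ 2 + ρ * (a + 1.5 * ρ) - 1|) *
      exp (-a ^ 2 / 2 + (ρ * a) / 2 - ρ ^ 2 / 8) ≤ 27.5 := by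
  have hr2 : ρ ^ 2 ≤ 1 := by nlinarith
  have hr0 : 0 < ρ ^ 2 := by positivity
  have e2 : exp (-a ^ 2 / 2 + (ρ * a) / 2 - ρ ^ 2 / 8) = exp (-(a - 0.5 * ρ) ^ 2 / 2) := by
    congr 1; ring
  rw [e2]
  set x := a - 0.5 * ρ with hx
  have hv : a + 1.5 * ρ = x + 2 * ρ := by rw [hx]; ring
  have hvp : 0 ≤ x + 2 * ρ := by rw [← hv]; positivity
  rw [hv, abs_of_nonneg hvp]
  have hxa := le_abs_self x
  have h3 : ρ * x ≤ |x| := by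
    have := mul_le_mul_of_nonneg_left hxa h0.le
    nlinarith [abs_nonneg x]
  have t1 := aux_t x
  have t2 := aux_e x
  have t3 := aux_t2 x
  have p := exp_pos (-x ^ 2 / 2)
  constructor
  · calc _ ≤ (4 + |x|) * exp (-x ^ 2 / 2) := mul_le_mul_of_nonneg_right (by nlinarith) p.le
      _ ≤ _ := by nlinarith
  · have hn : 0 ≤ ρ * (x + 2 * ρ) := by positivity
    have : |(x + 2 * ρ) ^ 2 + ρ * (x + 2 * ρ) - 1| ≤ x ^ 2 + 5 * |x| + 5 := by
      rw [abs_le]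
      constructor
      · nlinarith [sq_nonneg (x + 2 * ρ), sq_nonneg x, abs_nonneg x]
      · nlinarith
    calc _ ≤ (x ^ 2 + 10 * |x| + 19) * exp (-x ^ 2 / 2) :=
          mul_le_mul_of_nonneg_right (by nlinarith) p.le
      _ ≤ _ := by nlinarith

set_option maxHeartbeats 1000000 in
lemma core1 (σ u E : ℝ) (hσ : 1 ≤ σ) (hE : 0 < E) (hc : (u ≤ 0 ∧ E ≤ 1) ∨ (0 ≤ u ∧ E ≤ exp u)) :
    exp (-(σ ^ 2 * u ^ 2) / 2 - 3 * u / 2 - 1 / (8 * σ ^ 2)) * E ^ 2 *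
      (2 + |σ ^ 2 * u + 3 / 2| * (E / exp u)) ≤ 10 * σ ^ 2 * exp (3 / σ ^ 2) ∧
    exp (-(σ ^ 2 * u ^ 2) / 2 - 3 * u / 2 - 1 / (8 * σ ^ 2)) * E ^ 2 *
      (4 + 5 * |σ ^ 2 * u + 3 / 2| * (E / exp u) +
        |(σ ^ 2 * u + 3 / 2) ^ 2 + (σ ^ 2 * u + 3 / 2) - σ ^ 2| * (E / exp u) ^ 2)
      ≤ 27.5 * σ ^ 2 * exp (9 / (2 * σ ^ 2)) := by
  have hs : 0 < σ := by linarith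
  obtain ⟨ρ, hρ⟩ : ∃ ρ, ρ = 1 / σ := ⟨_, rfl⟩
  have h0 : 0 < ρ := by rw [hρ]; positivity
  have h1 : ρ ≤ 1 := by rw [hρ, div_le_one hs]; exact hσ
  have hσρ : σ = 1 / ρ := by rw [hρ]; field_simp
  obtain ⟨a, ha⟩ : ∃ a, a = σ * u := ⟨_, rfl⟩
  have hu : u = ρ * a := by rw [ha, hρ]; field_simp
  have x1 : -(σ ^ 2 * u ^ 2) / 2 - 3 * u / 2 - 1 / (8 * σ ^ 2)
      = -a ^ 2 / 2 - 3 * (ρ * a) / 2 - ρ ^ 2 / 8 := by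
    rw [hu, hσρ]; field_simp
  have x2 : |σ ^ 2 * u + 3 / 2| = σ ^ 2 * (ρ * |a + 1.5 * ρ|) := by
    have : σ ^ 2 * u + 3 / 2 = σ * (a + 1.5 * ρ) := by
      rw [hu, hσρ]; field_simp; ring
    rw [this, abs_mul, abs_of_pos hs, hσρ]; field_simp
  have x3 : |(σ ^ 2 * u + 3 / 2) ^ 2 + (σ ^ 2 * u + 3 / 2) - σ ^ 2|
      = σ ^ 2 * |(a + 1.5 * ρ) ^ 2 + ρ * (a + 1.5 * ρ) - 1| := by
    have : (σ ^ 2 * u + 3 / 2) ^ 2 + (σ ^ 2 * u + 3 / 2) - σ ^ 2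
        = σ ^ 2 * ((a + 1.5 * ρ) ^ 2 + ρ * (a + 1.5 * ρ) - 1) := by
      rw [hu, hσρ]; field_simp; ring
    rw [this, abs_mul, abs_of_pos (by positivity : 0 < σ ^ 2)]
  have x4 : 3 / σ ^ 2 = 3 * ρ ^ 2 := by rw [hσρ]; field_simp
  have x5 : 9 / (2 * σ ^ 2) = 9 / 2 * ρ ^ 2 := by rw [hσρ]; field_simp
  have x6 : σ ^ 2 * ρ ^ 2 = 1 := by rw [hσρ]; field_simp
  rw [x1, x2, x3, x4, x5]
  set V := ρ * |a + 1.5 * ρ| with hV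
  set P := |(a + 1.5 * ρ) ^ 2 + ρ * (a + 1.5 * ρ) - 1| with hP
  set H := exp (-a ^ 2 / 2 - 3 * (ρ * a) / 2 - ρ ^ 2 / 8) with hH
  have hHp : 0 < H := exp_pos _
  have hVp : 0 ≤ V := by positivity
  have hPp : 0 ≤ P := abs_nonneg _
  have r1 : H * E ^ 2 * (2 + σ ^ 2 * V * (E / exp u))
      = σ ^ 2 * (H * E ^ 2 * (2 * ρ ^ 2 + V * (E / exp u))) := by
    linear_combination (-2 * H * E ^ 2) * x6
  have r2 : H * E ^ 2 * (4 + 5 * (σ ^ 2 * V) * (E / exp u) + σ ^ 2 * P * (E / exp u) ^ 2)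
      = σ ^ 2 * (H * E ^ 2 * (4 * ρ ^ 2 + 5 * V * (E / exp u) + P * (E / exp u) ^ 2)) := by
    linear_combination (-4 * H * E ^ 2) * x6
  rw [r1, r2]
  have hs2 : 0 < σ ^ 2 := by positivity
  suffices hh : H * E ^ 2 * (2 * ρ ^ 2 + V * (E / exp u)) ≤ 10 * exp (3 * ρ ^ 2) ∧
      H * E ^ 2 * (4 * ρ ^ 2 + 5 * V * (E / exp u) + P * (E / exp u) ^ 2)
        ≤ 27.5 * exp (9 / 2 * ρ ^ 2) by
    constructor
    · refine (mul_le_mul_of_nonneg_left hh.1 hs2.le).trans_eq ?_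
      ring
    · refine (mul_le_mul_of_nonneg_left hh.2 hs2.le).trans_eq ?_
      ring
  rcases hc with ⟨hu0, hE1⟩ | ⟨hu0, hE1⟩
  · obtain ⟨l1, l2, l3, l4, l5⟩ := low_bounds a ρ h0 h1
    have d : E / exp u ≤ exp (-u) := by
      rw [exp_neg, div_eq_mul_inv]
      exact mul_le_of_le_one_left (inv_pos.2 (exp_pos u)).le hE1
    have E2 : E ^ 2 ≤ 1 := pow_le_one₀ hE.le hE1
    have hr2 : ρ ^ 2 ≤ 1 := pow_le_one₀ h0.le h1
    have q1 : H * exp (-u) = exp (-a ^ 2 / 2 - 5 * (ρ * a) / 2 - ρ ^ 2 / 8) := by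
      rw [hH, ← exp_add, hu]; congr 1; ring
    have q2 : H * exp (-u) ^ 2 = exp (-a ^ 2 / 2 - 7 * (ρ * a) / 2 - ρ ^ 2 / 8) := by
      rw [hH, ← exp_nat_mul, ← exp_add, hu]; congr 1; push_cast; ring
    rw [← hH] at l1 l2
    rw [← q1, ← hV] at l3 l4
    rw [← q2, ← hP] at l5
    have dd : 0 < E / exp u := by positivity
    constructor
    · calc _ ≤ H * 1 * (2 * ρ ^ 2 + V * exp (-u)) := by gcongr
        _ = 2 * (ρ ^ 2 * H) + V * (H * exp (-u)) := by ring
        _ ≤ 2 * exp (3 * ρ ^ 2) + (0.708 + ρ ^ 2) * exp (3 * ρ ^ 2) := by linarith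
        _ = (2.708 + ρ ^ 2) * exp (3 * ρ ^ 2) := by ring
        _ ≤ _ := mul_le_mul_of_nonneg_right (by linarith) (exp_pos _).le
    · calc _ ≤ H * 1 * (4 * ρ ^ 2 + 5 * V * exp (-u) + P * exp (-u) ^ 2) := by gcongr
        _ = 4 * (ρ ^ 2 * H) + 5 * (V * (H * exp (-u))) + P * (H * exp (-u) ^ 2) := by ring
        _ ≤ _ := by linarith [exp_pos (9 / 2 * ρ ^ 2)]
  · have ha0 : 0 ≤ a := by rw [ha]; positivity
    obtain ⟨l1, l2⟩ := high_bounds a ρ ha0 h0 h1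
    have d : E / exp u ≤ 1 := by rw [div_le_one (exp_pos u)]; exact hE1
    have q1 : H * exp u ^ 2 = exp (-a ^ 2 / 2 + (ρ * a) / 2 - ρ ^ 2 / 8) := by
      rw [hH, ← exp_nat_mul, ← exp_add, hu]; congr 1; push_cast; ring
    rw [← q1, ← hV] at l1 l2
    rw [← hP] at l2
    have dd : 0 < E / exp u := by positivity
    have o1 : 1 ≤ exp (3 * ρ ^ 2) := one_le_exp (by positivity)
    have o2 : 1 ≤ exp (9 / 2 * ρ ^ 2) := one_le_exp (by positivity)
    constructor
    · calc _ ≤ H * exp u ^ 2 * (2 * ρ ^ 2 + V * 1) := by gcongr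
        _ ≤ _ := by linarith
    · calc _ ≤ H * exp u ^ 2 * (4 * ρ ^ 2 + 5 * V * 1 + P * 1 ^ 2) := by gcongr
        _ ≤ _ := by linarith

noncomputable def uf (q s : ℝ) : ℝ := Real.log ((Real.exp s - (1 - q)) / q)
noncomputable def rf (q s : ℝ) : ℝ := Real.exp s / (Real.exp s - (1 - q))
noncomputable def Hf (σ q s : ℝ) : ℝ :=
  Real.exp (-(σ ^ 2 * uf q s ^ 2) / 2 - 3 * uf q s / 2 - 1 / (8 * σ ^ 2))
noncomputable def W0 (σ q s : ℝ) : ℝ := σ / (√(2 * π) * q) * (Hf σ q s * Real.exp s ^ 2)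
noncomputable def W1 (σ q s : ℝ) : ℝ := σ / (√(2 * π) * q) *
  (Hf σ q s * Real.exp s ^ 2 * (2 - (σ ^ 2 * uf q s + 3 / 2) * rf q s))
noncomputable def W2 (σ q s : ℝ) : ℝ := σ / (√(2 * π) * q) *
  (Hf σ q s * Real.exp s ^ 2 * (4 - 5 * (σ ^ 2 * uf q s + 3 / 2) * rf q s +
    ((σ ^ 2 * uf q s + 3 / 2) ^ 2 + (σ ^ 2 * uf q s + 3 / 2) - σ ^ 2) * rf q s ^ 2))

lemma hd_u (q s : ℝ) (hq0 : 0 < q) (hs : 0 < exp s - (1 - q)) :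
    HasDerivAt (uf q) (rf q s) s := by
  have := (((hasDerivAt_exp s).sub_const (1 - q)).div_const q).log (by positivity)
  refine this.congr_deriv ?_
  unfold rf; field_simp

lemma hd_r (q s : ℝ) (hs : 0 < exp s - (1 - q)) :
    HasDerivAt (rf q) (rf q s * (1 - rf q s)) s := by
  have := (hasDerivAt_exp s).div ((hasDerivAt_exp s).sub_const (1 - q)) hs.ne'
  refine this.congr_deriv ?_
  unfold rf; field_simp

lemma hd_H (σ q s : ℝ) (hq0 : 0 < q) (hs : 0 < exp s - (1 - q)) :
    HasDerivAt (Hf σ q) (-(σ ^ 2 * uf q s + 3 / 2) * rf q s * Hf σ q s) s := by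
  have hu := hd_u q s hq0 hs
  have := (((((hu.pow 2).const_mul (σ ^ 2)).neg.div_const 2).sub
    ((hu.const_mul 3).div_const 2)).sub_const (1 / (8 * σ ^ 2))).exp
  refine this.congr_deriv ?_
  simp [Hf]; ring

lemma hd_HE (σ q s : ℝ) (hq0 : 0 < q) (hs : 0 < exp s - (1 - q)) :
    HasDerivAt (fun s => Hf σ q s * exp s ^ 2)
      (Hf σ q s * exp s ^ 2 * (2 - (σ ^ 2 * uf q s + 3 / 2) * rf q s)) s := by
  have := (hd_H σ q s hq0 hs).mul ((hasDerivAt_exp s).pow 2)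
  refine this.congr_deriv ?_
  simp; ring

lemma hd_W0 (σ q s : ℝ) (hq0 : 0 < q) (hs : 0 < exp s - (1 - q)) :
    HasDerivAt (W0 σ q) (W1 σ q s) s := (hd_HE σ q s hq0 hs).const_mul _

lemma hd_W1 (σ q s : ℝ) (hq0 : 0 < q) (hs : 0 < exp s - (1 - q)) :
    HasDerivAt (W1 σ q) (W2 σ q s) s := by
  have := ((hd_HE σ q s hq0 hs).mul (((((hd_u q s hq0 hs).const_mul (σ ^ 2)).add_const
    (3 / 2)).mul (hd_r q s hs)).const_sub 2)).const_mul (σ / (√(2 * π) * q))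
  refine this.congr_deriv ?_
  simp only [W2, Pi.mul_apply]; ring

lemma pld_eq (σ q s : ℝ) (hσ : 1 ≤ σ) (hq0 : 0 < q) (hl : s ∈ Ioi (log (1 - q)))
    (hs : 0 < exp s - (1 - q)) : pld σ q s = W0 σ q s := by
  have hσ0 : 0 < σ := by linarith
  have hy : exp (uf q s) = (exp s - (1 - q)) / q := by
    unfold uf; rw [exp_log (by positivity)]
  have hg : gfun σ q s = σ ^ 2 * uf q s + 1 / 2 := rfl
  unfold pld
  rw [indicator_of_mem hl, ffun, hg, gderiv, W0]
  have h1 : exp (-(σ ^ 2 * uf q s + 1 / 2 - 1) ^ 2 / (2 * σ ^ 2))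
      = Hf σ q s * exp (uf q s) ^ 2 := by
    rw [Hf, ← exp_nat_mul, ← exp_add]; congr 1; push_cast; field_simp; ring
  have h2 : exp (-(σ ^ 2 * uf q s + 1 / 2) ^ 2 / (2 * σ ^ 2))
      = Hf σ q s * exp (uf q s) := by
    rw [Hf, ← exp_add]; congr 1; field_simp; ring
  have h3 : √(2 * π * σ ^ 2) = √(2 * π) * σ := by
    rw [sqrt_mul (by positivity), sqrt_sq hσ0.le]
  have h4 : 0 < √(2 * π) := by positivity
  rw [h1, h2, h3, hy]
  field_simp
  ring

theorem pld_derivative_bounds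
    (σ q : ℝ) (hσ : 1 ≤ σ) (hq0 : 0 < q) (hq1 : q < 1) :
    ∀ s ∈ Set.Ioi (Real.log (1 - q)),
      |deriv (pld σ q) s| ≤ 4 * Real.exp (3 / σ ^ 2) * σ ^ 3 / q ^ 2 ∧
      |deriv (deriv (pld σ q)) s| ≤ 11 * Real.exp (9 / (2 * σ ^ 2)) * σ ^ 3 / q ^ 3 := by
  have hpos : ∀ s ∈ Ioi (log (1 - q)), 0 < exp s - (1 - q) := by
    intro s hs
    have := (log_lt_iff_lt_exp (by linarith : 0 < 1 - q)).1 hs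
    linarith
  have hd1 : ∀ s ∈ Ioi (log (1 - q)), deriv (pld σ q) s = W1 σ q s := by
    intro s hs
    have : pld σ q =ᶠ[nhds s] W0 σ q := by
      filter_upwards [isOpen_Ioi.mem_nhds hs] with t ht
      exact pld_eq σ q t hσ hq0 ht (hpos t ht)
    rw [this.deriv_eq]
    exact (hd_W0 σ q s hq0 (hpos s hs)).deriv
  intro s hs
  have hd2 : deriv (deriv (pld σ q)) s = W2 σ q s := by
    have : deriv (pld σ q) =ᶠ[nhds s] W1 σ q := by
      filter_upwards [isOpen_Ioi.mem_nhds hs] with t ht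
      exact hd1 t ht
    rw [this.deriv_eq]
    exact (hd_W1 σ q s hq0 (hpos s hs)).deriv
  rw [hd1 s hs, hd2]
  have hp := hpos s hs
  have hσ0 : 0 < σ := by linarith
  have hy : exp (uf q s) = (exp s - (1 - q)) / q := by
    unfold uf; rw [exp_log (by positivity)]
  have hE : exp s = q * exp (uf q s) + (1 - q) := by rw [hy]; field_simp; ring
  have hr : rf q s = exp s / exp (uf q s) / q := by rw [hy, rf]; field_simp
  have hc : (uf q s ≤ 0 ∧ exp s ≤ 1) ∨ (0 ≤ uf q s ∧ exp s ≤ exp (uf q s)) := by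
    rcases le_total (uf q s) 0 with h | h
    · left
      have := exp_le_one_iff.2 h
      exact ⟨h, by nlinarith⟩
    · right
      have := one_le_exp h
      exact ⟨h, by nlinarith⟩
  obtain ⟨c1, c2⟩ := core1 σ (uf q s) (exp s) hσ (exp_pos s) hc
  have hsq : 2.5 ≤ √(2 * π) := by
    apply le_sqrt_of_sq_le
    nlinarith [pi_gt_d2]
  unfold W1 W2
  change Hf σ q s * _ * _ ≤ _ at c1
  change Hf σ q s * _ * _ ≤ _ at c2
  have hHp : 0 < Hf σ q s := exp_pos _
  set Z := √(2 * π)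
  set v := σ ^ 2 * uf q s + 3 / 2 with hv
  set H := Hf σ q s
  set E := exp s with hEE
  have hEp : 0 < E := exp_pos s
  obtain ⟨R, hR⟩ : ∃ R, R = E / exp (uf q s) := ⟨_, rfl⟩
  have hRp : 0 < R := by rw [hR]; positivity
  have hZ : 0 < Z := by linarith
  rw [hr]
  rw [← hR] at c1 c2 ⊢
  have ha : ∀ X, |σ / (Z * q) * (H * E ^ 2 * X)| = σ / (Z * q) * (H * E ^ 2 * |X|) := by
    intro X
    rw [abs_mul, abs_mul (H * E ^ 2), abs_of_pos (by positivity : 0 < H * E ^ 2),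
      abs_of_pos (by positivity : 0 < σ / (Z * q))]
  rw [ha, ha]
  constructor
  · have b1 : |2 - v * (R / q)| ≤ (2 + |v| * R) / q := by
      have : 2 - v * (R / q) = (2 * q - v * R) / q := by field_simp
      rw [this, abs_div, abs_of_pos hq0]
      gcongr
      refine (abs_sub _ _).trans ?_
      rw [abs_mul v, abs_of_pos hRp, abs_of_pos (by positivity : 0 < 2 * q)]
      linarith
    calc _ ≤ σ / (Z * q) * (H * E ^ 2 * ((2 + |v| * R) / q)) := by gcongr
      _ = σ / (Z * q ^ 2) * (H * E ^ 2 * (2 + |v| * R)) := by field_simp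
      _ ≤ σ / (Z * q ^ 2) * (10 * σ ^ 2 * exp (3 / σ ^ 2)) := by gcongr
      _ ≤ σ / (2.5 * q ^ 2) * (10 * σ ^ 2 * exp (3 / σ ^ 2)) := by gcongr
      _ = _ := by field_simp; norm_num
  · have b1 : |4 - 5 * v * (R / q) + (v ^ 2 + v - σ ^ 2) * (R / q) ^ 2|
        ≤ (4 + 5 * |v| * R + |v ^ 2 + v - σ ^ 2| * R ^ 2) / q ^ 2 := by
      have : 4 - 5 * v * (R / q) + (v ^ 2 + v - σ ^ 2) * (R / q) ^ 2
          = (4 * q ^ 2 - q * (5 * v * R) + (v ^ 2 + v - σ ^ 2) * R ^ 2) / q ^ 2 := by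
        field_simp
      rw [this, abs_div, abs_of_pos (by positivity : 0 < q ^ 2)]
      gcongr
      refine (abs_add_le _ _).trans ?_
      rw [abs_mul _ (R ^ 2), abs_of_pos (by positivity : 0 < R ^ 2)]
      gcongr
      refine (abs_sub _ _).trans ?_
      rw [abs_mul q, abs_mul _ R, abs_mul 5, abs_of_pos hRp, abs_of_pos hq0,
        abs_of_pos (by positivity : 0 < 4 * q ^ 2), abs_of_pos (by norm_num : (0 : ℝ) < 5)]
      have : 0 ≤ 5 * |v| * R := by positivity
      nlinarith
    calc _ ≤ σ / (Z * q) * (H * E ^ 2 *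
            ((4 + 5 * |v| * R + |v ^ 2 + v - σ ^ 2| * R ^ 2) / q ^ 2)) := by gcongr
      _ = σ / (Z * q ^ 3) * (H * E ^ 2 *
            (4 + 5 * |v| * R + |v ^ 2 + v - σ ^ 2| * R ^ 2)) := by field_simp
      _ ≤ σ / (Z * q ^ 3) * (27.5 * σ ^ 2 * exp (9 / (2 * σ ^ 2))) := by gcongr
      _ ≤ σ / (2.5 * q ^ 3) * (27.5 * σ ^ 2 * exp (9 / (2 * σ ^ 2))) := by gcongr
      _ = _ := by field_simp; norm_num
end
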